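/- arXiv:2505.22875 — 2 statements merged into one kernel-verified Lean document; each statement's English description precedes it below -/
import Mathlib

section
/- Fix integers m ≥ 2 and d_1, …, d_m ≥ 1, and set D = ∑_{1≤k<ℓ≤m} d_k·d_ℓ. For every ε > 0 there exists n0 such that the following holds for all n ≥ n0: for every choice of graphs H_1, …, H_m on the vertex set {1,…,n} with H_i being d_i-regular for each i, if σ_1, …, σ_m are independent, uniformly random permutations of {1,…,n}, then the probability that the images σ_1(H_1), …, σ_m(H_m) are pairwise edge-disjoint differs from exp(−D/2) by at most ε. -/
open Filter Topology

/-- Degree of a vertex in a graph on `Fin n`. -/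
noncomputable def gDeg {n : ℕ} (G : SimpleGraph (Fin n)) (v : Fin n) : ℕ :=
  Nat.card {w : Fin n // G.Adj v w}

/-- `G` is a `d`-regular graph. -/
def IsRegularGraph {n : ℕ} (G : SimpleGraph (Fin n)) (d : ℕ) : Prop :=
  ∀ v, gDeg G v = d

open scoped Classical in
/-- The uniform probability distribution `μ_{d,n}` on the `d`-regular graphs on `{1,…,n}`. -/
noncomputable def mu (n d : ℕ) : SimpleGraph (Fin n) → ℝ := fun G =>
  if IsRegularGraph G d then
    (Nat.card {H : SimpleGraph (Fin n) // IsRegularGraph H d} : ℝ)⁻¹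
  else 0

/-- `p` is a probability distribution on a finite or countable space. -/
def IsProbC {α : Type*} (p : α → ℝ) : Prop :=
  (∀ x, 0 ≤ p x) ∧ ∑' x, p x = 1

/-- Probability of an event `A` under the distribution `p`. -/
noncomputable def probOf {α : Type*} (p : α → ℝ) (A : Set α) : ℝ := ∑' x : A, p x

/-- Total variation distance. -/
noncomputable def tvDist {α : Type*} (p q : α → ℝ) : ℝ := (1/2) * ∑' x, |p x - q x|

/-- `π` is a coupling of `p` and `q`. -/
def IsCoupling {α β : Type*} (π : α × β → ℝ) (p : α → ℝ) (q : β → ℝ) : Prop :=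
  IsProbC π ∧ (∀ a, ∑' b, π (a, b) = p a) ∧ (∀ b, ∑' a, π (a, b) = q b)

/-- Expectation of `f` under the distribution `p`. -/
noncomputable def expec {α : Type*} (p f : α → ℝ) : ℝ := ∑' x, p x * f x

section Overlap

open Finset Equiv

open scoped Nat Classical

variable {V : Type*} [Fintype V] [DecidableEq V]

/-- The arcs of `H` which the permutation `σ` maps to arcs of `G`. -/
noncomputable def overlap (G H : SimpleGraph V) (σ : Perm V) : Finset (V × V) :=
  {p | H.Adj p.1 p.2 ∧ G.Adj (σ p.1) (σ p.2)}

/-- The permutations mapping exactly `j` arcs of `H` to arcs of `G`. -/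
noncomputable def permsWithOverlap (G H : SimpleGraph V) (j : ℕ) : Finset (Perm V) :=
  {σ | #(overlap G H σ) = j}

variable {G H : SimpleGraph V} {a b : ℕ}

omit [DecidableEq V] in
lemma mem_overlap {σ : Perm V} {p : V × V} :
    p ∈ overlap G H σ ↔ H.Adj p.1 p.2 ∧ G.Adj (σ p.1) (σ p.2) := by
  simp [overlap]

lemma even_card_overlap (σ : Perm V) : Even #(overlap G H σ) := by
  have h : #(overlap G H σ) = ∑ v, (H ⊓ G.comap σ).degree v := by
    rw [overlap, ← univ_product_univ, card_filter, sum_product]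
    refine sum_congr rfl fun u _ => ?_
    rw [← card_filter, ← SimpleGraph.card_neighborFinset_eq_degree]
    congr 1
    ext v
    simp
  rw [h, SimpleGraph.sum_degrees_eq_twice_card_edges]
  exact even_two_mul _

omit [DecidableEq V] in
lemma card_filter_adj_perm (hG : ∀ v, #{w | G.Adj v w} = a) (σ : Perm V) (x : V) :
    #{w | G.Adj x (σ w)} = a := by
  rw [← hG x]
  exact card_equiv σ (by simp)

/-- Averaging over the transpositions `swap u w` with `w ∈ T` bounds the number of `σ` in `S` for
which `σ v` and `σ u` are adjacent. -/
lemma card_mul_card_filter_adj_le (hG : ∀ v, #{w | G.Adj v w} = a) {v u : V} {T : Finset V}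
    (hv : v ∉ T) (hu : u ∈ T) {S : Finset (Perm V)}
    (hS : ∀ σ ∈ S, ∀ w ∈ T, σ * swap u w ∈ S) :
    #T * #{σ ∈ S | G.Adj (σ v) (σ u)} ≤ a * #S := by
  have h1 : ∀ w ∈ T, #{σ ∈ S | G.Adj (σ v) (σ u)} ≤ #{σ ∈ S | G.Adj (σ v) (σ w)} := by
    intro w hw
    refine card_le_card_of_injOn (fun σ => σ * swap u w) ?_ ?_
    · intro σ hσ
      simp only [coe_filter, Set.mem_ofPred_eq] at hσ ⊢
      refine ⟨hS σ hσ.1 w hw, ?_⟩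
      have : swap u w v = v :=
        swap_apply_of_ne_of_ne (fun h => hv (h ▸ hu)) (fun h => hv (h ▸ hw))
      simpa [this] using hσ.2
    · intro σ _ τ _ h
      exact mul_right_cancel h
  calc #T * #{σ ∈ S | G.Adj (σ v) (σ u)}
      ≤ ∑ w ∈ T, #{σ ∈ S | G.Adj (σ v) (σ w)} := by
        simpa using card_nsmul_le_sum T _ _ h1
    _ = ∑ σ ∈ S, #{w ∈ T | G.Adj (σ v) (σ w)} := by
        simp only [card_filter]
        exact sum_comm
    _ ≤ ∑ σ ∈ S, a := by
        refine sum_le_sum fun σ _ => ?_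
        rw [← card_filter_adj_perm hG σ (σ v)]
        exact card_le_card (filter_subset_filter _ (subset_univ _))
    _ = a * #S := by simp [mul_comm]

lemma card_perm_adj_le (hG : ∀ v, #{w | G.Adj v w} = a) {v u : V} (h : u ≠ v) :
    (Fintype.card V - 1) * #{σ : Perm V | G.Adj (σ v) (σ u)} ≤ a * (Fintype.card V)! := by
  have := card_mul_card_filter_adj_le hG (v := v) (u := u) (T := univ.erase v) (S := univ)
    (by simp) (by simpa using h) (by simp)
  simpa [card_erase_of_mem, Fintype.card_perm] using this

lemma card_perm_adj_adj_le (hG : ∀ v, #{w | G.Adj v w} = a) {v u z : V} (h : u ≠ v)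
    (hzv : z ≠ v) (hzu : z ≠ u) :
    (Fintype.card V - 1) * ((Fintype.card V - 2) *
      #{σ : Perm V | G.Adj (σ v) (σ u) ∧ G.Adj (σ v) (σ z)}) ≤
        a ^ 2 * (Fintype.card V)! := by
  have := card_mul_card_filter_adj_le hG (v := v) (u := z) (T := univ \ {v, u})
    (S := {σ : Perm V | G.Adj (σ v) (σ u)}) (by simp) (by simp [hzv, hzu]) (by
      intro σ hσ w hw
      simp only [mem_filter, mem_univ, true_and, Finset.mem_sdiff, mem_insert, mem_singleton,
        not_or] at hσ hw ⊢
      rw [Perm.mul_apply, Perm.mul_apply, swap_apply_of_ne_of_ne hzv.symm (Ne.symm hw.1),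
        swap_apply_of_ne_of_ne hzu.symm (Ne.symm hw.2)]
      exact hσ)
  rw [card_univ_sdiff, card_pair h.symm, filter_filter] at this
  calc _ ≤ (Fintype.card V - 1) * (a * #{σ : Perm V | G.Adj (σ v) (σ u)}) := by gcongr
    _ = a * ((Fintype.card V - 1) * #{σ : Perm V | G.Adj (σ v) (σ u)}) := by ring
    _ ≤ a * (a * (Fintype.card V)!) := Nat.mul_le_mul_left _ (card_perm_adj_le hG h)
    _ = _ := by ring

omit [DecidableEq V] in
lemma card_arcs (hH : ∀ v, #{w | H.Adj v w} = b) :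
    #{p : V × V | H.Adj p.1 p.2} = Fintype.card V * b := by
  rw [← univ_product_univ, card_filter, sum_product]
  simp only [← card_filter, hH]
  simp

lemma sum_card_overlap_le (hG : ∀ v, #{w | G.Adj v w} = a) (hH : ∀ v, #{w | H.Adj v w} = b) :
    (Fintype.card V - 1) * ∑ σ, #(overlap G H σ) ≤
      Fintype.card V * b * (a * (Fintype.card V)!) := by
  have h1 : ∑ σ, #(overlap G H σ) =
      ∑ p : V × V with H.Adj p.1 p.2, #{σ : Perm V | G.Adj (σ p.1) (σ p.2)} := by
    simp only [overlap, ← filter_filter, card_filter _ (filter _ _)]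
    rw [sum_comm]
    simp only [card_filter]
  rw [h1, mul_sum, ← card_arcs hH, ← smul_eq_mul (a := #_)]
  refine sum_le_card_nsmul _ _ _ fun p hp => card_perm_adj_le hG ?_
  exact (mem_filter.1 hp).2.ne'

/-- The pairs of distinct arcs `(v, u)`, `(v, z)` of `H` mapped by `σ` to arcs of `G`,
recorded as `(v, u, z)`. -/
noncomputable def overlapCherries (G H : SimpleGraph V) (σ : Perm V) : Finset (V × V × V) :=
  {t | (H.Adj t.1 t.2.1 ∧ H.Adj t.1 t.2.2 ∧ t.2.2 ≠ t.2.1) ∧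
    (G.Adj (σ t.1) (σ t.2.1) ∧ G.Adj (σ t.1) (σ t.2.2))}

lemma sum_card_overlapCherries_le (hG : ∀ v, #{w | G.Adj v w} = a)
    (hH : ∀ v, #{w | H.Adj v w} = b) :
    (Fintype.card V - 1) * (Fintype.card V - 2) * ∑ σ, #(overlapCherries G H σ) ≤
      Fintype.card V * b ^ 2 * (a ^ 2 * (Fintype.card V)!) := by
  have h1 : ∑ σ, #(overlapCherries G H σ) =
      ∑ t : V × V × V with (H.Adj t.1 t.2.1 ∧ H.Adj t.1 t.2.2 ∧ t.2.2 ≠ t.2.1),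
        #{σ : Perm V | G.Adj (σ t.1) (σ t.2.1) ∧ G.Adj (σ t.1) (σ t.2.2)} := by
    simp only [overlapCherries]
    simp_rw [← filter_filter
      (fun t : V × V × V => H.Adj t.1 t.2.1 ∧ H.Adj t.1 t.2.2 ∧ t.2.2 ≠ t.2.1),
      card_filter _ (filter _ _)]
    rw [sum_comm]
    simp only [card_filter]
  have h2 : #{t : V × V × V | H.Adj t.1 t.2.1 ∧ H.Adj t.1 t.2.2 ∧ t.2.2 ≠ t.2.1} ≤
      Fintype.card V * b ^ 2 := by
    calc _ ≤ #{t : V × V × V | H.Adj t.1 t.2.1 ∧ H.Adj t.1 t.2.2} :=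
          card_le_card (by grind)
      _ = ∑ v : V, #(({u | H.Adj v u} : Finset V) ×ˢ ({u | H.Adj v u} : Finset V)) := by
          rw [← univ_product_univ, card_filter, sum_product]
          refine sum_congr rfl fun v _ => ?_
          rw [← card_filter]
          congr 1
          ext ⟨x, y⟩
          simp
      _ = _ := by simp [card_product, hH, sq]
  rw [h1, mul_sum]
  calc _ ≤ _ • (a ^ 2 * (Fintype.card V)!) := by
        refine sum_le_card_nsmul _ _ _ fun t ht => ?_
        have := (mem_filter.1 ht).2
        rw [mul_assoc]
        exact card_perm_adj_adj_le hG this.1.ne' this.2.1.ne' this.2.2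
    _ ≤ _ := by rw [smul_eq_mul]; gcongr

/-- The vertices `w` for which composing `σ` with `swap v w` may change the overlap in other ways
than by removing the arcs of `H` at `v`. -/
noncomputable def exceptional (G H : SimpleGraph V) (σ : Perm V) (u v : V) : Finset V :=
  {w | w = u ∨ w = v ∨ (∃ z, H.Adj w z ∧ G.Adj (σ w) (σ z)) ∨
    (∃ z, H.Adj v z ∧ G.Adj (σ w) (σ z)) ∨ ∃ z, H.Adj w z ∧ G.Adj (σ v) (σ z)}

lemma card_exceptional_le (hG : ∀ v, #{w | G.Adj v w} = a) (hH : ∀ v, #{w | H.Adj v w} = b)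
    (σ : Perm V) (u v : V) :
    #(exceptional G H σ u v) ≤ 2 + #(overlap G H σ) + 2 * (a * b) := by
  have h : exceptional G H σ u v ⊆ ({u, v} ∪ (overlap G H σ).image Prod.fst) ∪
      ((({z | H.Adj v z} : Finset V).biUnion fun z => {w | G.Adj (σ z) (σ w)}) ∪
      (({z | G.Adj (σ v) (σ z)} : Finset V).biUnion fun z => {w | H.Adj z w})) := by
    intro w hw
    simp only [exceptional, mem_filter, mem_univ, true_and] at hw
    simp only [mem_union, mem_insert, mem_singleton, mem_image, mem_biUnion, mem_filter, mem_univ,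
      true_and, mem_overlap, Prod.exists, G.adj_comm _ (σ w), H.adj_comm _ w]
    grind
  have h1 := card_biUnion_le_card_mul ({z | H.Adj v z} : Finset V)
    (fun z => ({w | G.Adj (σ z) (σ w)} : Finset V)) a
    fun z _ => (card_filter_adj_perm hG σ (σ z)).le
  have h2 := card_biUnion_le_card_mul ({z | G.Adj (σ v) (σ z)} : Finset V)
    (fun z => ({w | H.Adj z w} : Finset V)) b fun z _ => (hH z).le
  rw [hH] at h1
  rw [card_filter_adj_perm hG] at h2
  calc _ ≤ _ := card_le_card h
    _ ≤ _ := (card_union_le _ _).trans (add_le_add (card_union_le _ _) (card_union_le _ _))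
    _ ≤ (2 + #(overlap G H σ)) + (b * a + a * b) := by
      gcongr
      · exact card_le_two
      · exact card_image_le
    _ = _ := by ring

lemma card_overlap_mul_swap_add_two {σ : Perm V} {u v w : V} (huv : (u, v) ∈ overlap G H σ)
    (hw : w ∉ exceptional G H σ u v)
    (h : ∀ z, H.Adj v z → G.Adj (σ v) (σ z) → z = u) :
    #(overlap G H (σ * swap v w)) + 2 = #(overlap G H σ) := by
  simp only [exceptional, mem_filter, mem_univ, true_and, not_or, not_exists, not_and] at hw
  obtain ⟨hwu, hwv, h2, h3, h4⟩ := hw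
  have huv' := mem_overlap.1 huv
  have hne : u ≠ v := huv'.1.ne
  have key : overlap G H (σ * swap v w) = overlap G H σ \ {(u, v), (v, u)} := by
    ext ⟨p, q⟩
    simp only [Finset.mem_sdiff, mem_overlap, Perm.mul_apply, mem_insert, mem_singleton,
      Prod.mk.injEq, swap_apply_def]
    have hs := fun x y => H.adj_comm x y
    have gs := fun x y => G.adj_comm x y
    have hl := fun x => H.loopless.irrefl x
    have gl := fun x => G.loopless.irrefl x
    grind
  have hsub : {(u, v), (v, u)} ⊆ overlap G H σ := by
    intro p hp
    simp only [mem_insert, mem_singleton] at hp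
    rcases hp with rfl | rfl
    · exact huv
    · exact mem_overlap.2 ⟨huv'.1.symm, huv'.2.symm⟩
  have hc : #({(u, v), (v, u)} : Finset (V × V)) = 2 := card_pair (by simp [hne])
  rw [key, ← hc]
  exact card_sdiff_add_card_eq_card hsub

lemma card_overlap_le_add (hH : ∀ v, #{w | H.Adj v w} = b) (σ : Perm V) (v w : V) :
    #(overlap G H σ) ≤ #(overlap G H (σ * swap v w)) + 4 * b := by
  let N : V → Finset V := fun x => {y | H.Adj x y}
  have h : overlap G H σ ⊆ overlap G H (σ * swap v w) ∪
      (({v, w} : Finset V).biUnion (fun x => (N x).image (x, ·)) ∪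
        ({v, w} : Finset V).biUnion (fun x => (N x).image (·, x))) := by
    rintro ⟨p, q⟩ hpq
    have hpq' := mem_overlap.1 hpq
    have hs := H.adj_comm p q
    simp only [N, mem_union, mem_overlap, Perm.mul_apply, mem_biUnion, mem_insert, mem_singleton,
      mem_image, mem_filter, mem_univ, true_and, Prod.mk.injEq, swap_apply_def]
    grind
  have h1 := card_biUnion_le_card_mul ({v, w} : Finset V) (fun x => (N x).image (x, ·)) b
    fun x _ => card_image_le.trans (hH x).le
  have h2 := card_biUnion_le_card_mul ({v, w} : Finset V) (fun x => (N x).image (·, x)) b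
    fun x _ => card_image_le.trans (hH x).le
  have h3 : #({v, w} : Finset V) * b ≤ 2 * b := Nat.mul_le_mul_right _ card_le_two
  have := card_le_card h
  have := (card_union_le _ _).trans' this
  have := card_union_le (({v, w} : Finset V).biUnion (fun x => (N x).image (x, ·)))
     (({v, w} : Finset V).biUnion (fun x => (N x).image (·, x)))
  omega

lemma card_sigma_overlap (j : ℕ) :
    #((permsWithOverlap G H j).sigma fun σ => {t : V × V × V | (t.1, t.2.1) ∈ overlap G H σ}) =
      #(permsWithOverlap G H j) * (j * Fintype.card V) := by
  rw [card_sigma, ← smul_eq_mul (a := #_)]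
  refine sum_eq_card_nsmul fun σ hσ => ?_
  rw [← (mem_filter.1 hσ).2, ← card_univ, ← card_product]
  exact card_equiv (Equiv.prodAssoc V V V).symm (by simp)

lemma card_sigma_adj_adj (hG : ∀ v, #{w | G.Adj v w} = a) (hH : ∀ v, #{w | H.Adj v w} = b)
    (j : ℕ) :
    #((permsWithOverlap G H j).sigma fun σ =>
      {t : V × V × V | H.Adj t.1 t.2.1 ∧ G.Adj (σ t.1) (σ t.2.2)}) =
      #(permsWithOverlap G H j) * (Fintype.card V * (b * a)) := by
  rw [card_sigma, ← smul_eq_mul (a := #_)]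
  refine sum_eq_card_nsmul fun σ _ => ?_
  rw [← univ_product_univ, card_filter, sum_product, ← card_univ, ← smul_eq_mul (a := #_)]
  refine sum_eq_card_nsmul fun u _ => ?_
  rw [← card_filter, ← hH u, ← card_filter_adj_perm hG σ (σ u), ← card_product]
  congr 1
  ext ⟨v, w⟩
  simp

/-- The tuples `(σ, u, v, w)` such that `σ` overlaps in `(u, v)` and in at most `M` arcs, for which
composing `σ` with `swap v w` may fail to remove exactly the arcs between `u` and `v` from the
overlap. -/
noncomputable def badTuples (G H : SimpleGraph V) (M : ℕ) : Finset ((_ : Perm V) × V × V × V) :=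
  ({σ | #(overlap G H σ) ≤ M} : Finset (Perm V)).sigma fun σ =>
    {t | (t.1, t.2.1) ∈ overlap G H σ ∧ (t.2.2 ∈ exceptional G H σ t.1 t.2.1 ∨
      ∃ z, H.Adj t.2.1 z ∧ G.Adj (σ t.2.1) (σ z) ∧ z ≠ t.1)}

lemma card_badTuples_le (hG : ∀ v, #{w | G.Adj v w} = a) (hH : ∀ v, #{w | H.Adj v w} = b)
    (hV : 4 ≤ Fintype.card V) (M : ℕ) :
    #(badTuples G H M) ≤
      (M * (2 + M + 2 * (a * b)) + 4 * (a ^ 2 * b ^ 2)) * (Fintype.card V)! := by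
  set n := Fintype.card V with hn
  have hfib : ∀ σ : Perm V, #(overlap G H σ) ≤ M →
      #{t : V × V × V | (t.1, t.2.1) ∈ overlap G H σ ∧ (t.2.2 ∈ exceptional G H σ t.1 t.2.1 ∨
        ∃ z, H.Adj t.2.1 z ∧ G.Adj (σ t.2.1) (σ z) ∧ z ≠ t.1)} ≤
      M * (2 + M + 2 * (a * b)) + n * #(overlapCherries G H σ) := by
    intro σ hσ
    have hsub : ({t : V × V × V | (t.1, t.2.1) ∈ overlap G H σ ∧
        (t.2.2 ∈ exceptional G H σ t.1 t.2.1 ∨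
          ∃ z, H.Adj t.2.1 z ∧ G.Adj (σ t.2.1) (σ z) ∧ z ≠ t.1)} : Finset _) ⊆
        ((overlap G H σ).biUnion fun p => (exceptional G H σ p.1 p.2).image (p.1, p.2, ·)) ∪
        (univ ×ˢ overlapCherries G H σ).image fun q => (q.2.2.1, q.2.1, q.1) := by
      rintro ⟨u, v, w⟩ ht
      simp only [mem_filter, mem_univ, true_and] at ht
      obtain ⟨huv, hw | ⟨z, hz⟩⟩ := ht
      · exact mem_union_left _ (mem_biUnion.2 ⟨(u, v), huv, mem_image.2 ⟨w, hw, rfl⟩⟩)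
      · have huv' := mem_overlap.1 huv
        refine mem_union_right _ (mem_image.2 ⟨(w, v, u, z), ?_, rfl⟩)
        simp only [overlapCherries, mem_product, mem_filter, mem_univ, true_and]
        exact ⟨⟨huv'.1.symm, hz.1, hz.2.2⟩, huv'.2.symm, hz.2.1⟩
    calc _ ≤ _ := card_le_card hsub
      _ ≤ _ := card_union_le _ _
      _ ≤ #(overlap G H σ) * (2 + M + 2 * (a * b)) + n * #(overlapCherries G H σ) := by
        refine add_le_add (card_biUnion_le_card_mul _ _ _ fun p _ => ?_) ?_
        · refine card_image_le.trans ((card_exceptional_le hG hH σ p.1 p.2).trans ?_)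
          gcongr
        · refine card_image_le.trans ?_
          rw [card_product, card_univ]
      _ ≤ _ := by gcongr
  have hch : n * ∑ σ, #(overlapCherries G H σ) ≤ 4 * (a ^ 2 * b ^ 2) * n ! := by
    have h := sum_card_overlapCherries_le hG hH
    rw [← hn] at h
    set S := ∑ σ, #(overlapCherries G H σ)
    obtain ⟨k, hk⟩ : ∃ k, n = k + 4 := ⟨n - 4, by omega⟩
    have hpos : 0 < (n - 1) * (n - 2) := Nat.mul_pos (by omega) (by omega)
    have hsq : n * n ≤ 4 * ((n - 1) * (n - 2)) := by
      rw [hk]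
      simp only [show k + 4 - 1 = k + 3 by omega, show k + 4 - 2 = k + 2 by omega]
      nlinarith
    refine Nat.le_of_mul_le_mul_left ?_ hpos
    calc (n - 1) * (n - 2) * (n * S) = n * ((n - 1) * (n - 2) * S) := by ring
      _ ≤ n * (n * b ^ 2 * (a ^ 2 * n !)) := Nat.mul_le_mul_left _ h
      _ = n * n * (a ^ 2 * b ^ 2 * n !) := by ring
      _ ≤ 4 * ((n - 1) * (n - 2)) * (a ^ 2 * b ^ 2 * n !) := Nat.mul_le_mul_right _ hsq
      _ = _ := by ring
  rw [badTuples, card_sigma]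
  calc _ ≤ ∑ σ : Perm V with #(overlap G H σ) ≤ M,
        (M * (2 + M + 2 * (a * b)) + n * #(overlapCherries G H σ)) :=
        sum_le_sum fun σ hσ => hfib σ (mem_filter.1 hσ).2
    _ ≤ ∑ σ : Perm V, (M * (2 + M + 2 * (a * b)) + n * #(overlapCherries G H σ)) :=
        sum_le_sum_of_subset (subset_univ _)
    _ = M * (2 + M + 2 * (a * b)) * n ! + n * ∑ σ, #(overlapCherries G H σ) := by
        rw [sum_add_distrib, mul_sum, sum_const, card_univ, Fintype.card_perm, smul_eq_mul,
          mul_comm n !]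
    _ ≤ _ := by rw [add_mul]; gcongr

/-- Composing `σ` with `swap v w` in a tuple `(σ, u, v, w)`. -/
def swapTuple (t : (_ : Perm V) × V × V × V) : (_ : Perm V) × V × V × V :=
  ⟨t.1 * swap t.2.2.1 t.2.2.2, t.2⟩

omit [Fintype V] in
lemma swapTuple_involutive : Function.Involutive (swapTuple (V := V)) := by
  rintro ⟨σ, u, v, w⟩
  simp [swapTuple, mul_assoc]

lemma card_overlap_of_notMem_badTuples {σ : Perm V} {u v w : V} {M : ℕ}
    (huv : (u, v) ∈ overlap G H σ) (hM : #(overlap G H σ) ≤ M)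
    (h : (⟨σ, u, v, w⟩ : (_ : Perm V) × V × V × V) ∉ badTuples G H M) :
    #(overlap G H (σ * swap v w)) + 2 = #(overlap G H σ) ∧ w ≠ u ∧ w ≠ v := by
  simp only [badTuples, mem_sigma, mem_filter, mem_univ, true_and, hM, huv, not_or, not_exists,
    not_and, not_not] at h
  refine ⟨card_overlap_mul_swap_add_two huv h.1 h.2, ?_⟩
  have := h.1
  simp only [exceptional, mem_filter, mem_univ, true_and, not_or] at this
  exact ⟨this.1, this.2.1⟩

lemma card_sigma_overlap_le (j M : ℕ) (hM : j + 2 ≤ M) :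
    #((permsWithOverlap G H (j + 2)).sigma
      fun σ => {t : V × V × V | (t.1, t.2.1) ∈ overlap G H σ}) ≤
    #((permsWithOverlap G H j).sigma fun σ =>
      {t : V × V × V | H.Adj t.1 t.2.1 ∧ G.Adj (σ t.1) (σ t.2.2)}) + #(badTuples G H M) := by
  refine (card_le_card (t := Finset.image swapTuple _ ∪ _) ?_).trans ((card_union_le _ _).trans
    (Nat.add_le_add_right card_image_le _))
  rintro ⟨σ, u, v, w⟩ ht
  simp only [mem_sigma, mem_filter, mem_univ, true_and, permsWithOverlap] at ht
  obtain ⟨hY, huv⟩ := ht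
  refine or_iff_not_imp_right.2 (fun hbad => ?_) |> mem_union.2
  obtain ⟨h, hu, hv⟩ := card_overlap_of_notMem_badTuples huv (hY.le.trans hM) hbad
  refine mem_image.2 ⟨swapTuple ⟨σ, u, v, w⟩, ?_, swapTuple_involutive _⟩
  have huv' := mem_overlap.1 huv
  simp only [swapTuple, mem_sigma, mem_filter, mem_univ, true_and, permsWithOverlap]
  refine ⟨by omega, huv'.1, ?_⟩
  simpa [swap_apply_of_ne_of_ne huv'.1.ne hu.symm] using huv'.2

lemma card_sigma_adj_adj_le (hH : ∀ v, #{w | H.Adj v w} = b) (j M : ℕ) (hM : j + 4 * b ≤ M) :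
    #((permsWithOverlap G H j).sigma fun σ =>
      {t : V × V × V | H.Adj t.1 t.2.1 ∧ G.Adj (σ t.1) (σ t.2.2)}) ≤
    #((permsWithOverlap G H (j + 2)).sigma
      fun σ => {t : V × V × V | (t.1, t.2.1) ∈ overlap G H σ}) + #(badTuples G H M) := by
  refine (card_le_card_of_injOn swapTuple ?_ swapTuple_involutive.injective.injOn).trans
    (card_union_le _ _)
  rintro ⟨σ, u, v, w⟩ ht
  simp only [coe_sigma, Set.mem_sigma_iff, mem_coe, mem_filter, mem_univ, true_and,
    permsWithOverlap] at ht
  obtain ⟨hY, huv, huw⟩ := ht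
  have hwu : u ≠ w := fun h => huw.ne (by rw [h])
  have hov : (u, v) ∈ overlap G H (σ * swap v w) := by
    simpa [mem_overlap, swap_apply_of_ne_of_ne huv.ne hwu] using ⟨huv, huw⟩
  have hle := card_overlap_le_add hH (G := G) (σ * swap v w) v w
  rw [mul_swap_mul_self] at hle
  refine mem_coe.2 (mem_union.2 (or_iff_not_imp_right.2 fun hbad => ?_))
  obtain ⟨h, -⟩ := card_overlap_of_notMem_badTuples hov (by omega) hbad
  rw [mul_swap_mul_self] at h
  simp only [swapTuple, mem_sigma, mem_filter, mem_univ, true_and, permsWithOverlap]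
  exact ⟨by omega, hov⟩

/-- The approximate recursion for the overlap counts. -/
lemma exists_abs_card_permsWithOverlap_le (a b j : ℕ) : ∃ C : ℕ, ∀ (V : Type) [Fintype V]
    [DecidableEq V] (G H : SimpleGraph V), (∀ v, #{w | G.Adj v w} = a) →
    (∀ v, #{w | H.Adj v w} = b) → 4 ≤ Fintype.card V →
    |((j + 2 : ℕ) : ℝ) * (#(permsWithOverlap G H (j + 2)) / (Fintype.card V)! : ℝ) -
      a * b * (#(permsWithOverlap G H j) / (Fintype.card V)! : ℝ)| ≤ C / Fintype.card V := by
  set M := j + 2 + 4 * b with hM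
  refine ⟨M * (2 + M + 2 * (a * b)) + 4 * (a ^ 2 * b ^ 2), fun V _ _ G H hG hH hV => ?_⟩
  have hbad := card_badTuples_le hG hH hV M
  have h1 := card_sigma_overlap_le (G := G) (H := H) j M (by omega)
  have h2 := card_sigma_adj_adj_le (G := G) hH j M (by omega)
  rw [card_sigma_overlap, card_sigma_adj_adj hG hH] at h1 h2
  set C := M * (2 + M + 2 * (a * b)) + 4 * (a ^ 2 * b ^ 2)
  set n := Fintype.card V
  set x := #(permsWithOverlap G H (j + 2))
  set y := #(permsWithOverlap G H j)
  have hn : (0 : ℝ) < n := by exact_mod_cast (by omega : 0 < n)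
  have hf : (0 : ℝ) < (n ! : ℝ) := by exact_mod_cast n.factorial_pos
  have h1' : (x * ((j + 2 : ℕ) * n) : ℝ) ≤ y * (n * (b * a)) + C * n ! := by
    exact_mod_cast h1.trans (Nat.add_le_add_left hbad _)
  have h2' : (y * (n * (b * a)) : ℝ) ≤ x * ((j + 2 : ℕ) * n) + C * n ! := by
    exact_mod_cast h2.trans (Nat.add_le_add_left hbad _)
  have : ((j + 2 : ℕ) : ℝ) * (x / n ! : ℝ) - a * b * (y / n ! : ℝ) =
      (x * ((j + 2 : ℕ) * n) - y * (n * (b * a))) / n ! / n := by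
    field_simp
  rw [this, abs_div, abs_of_pos hn, abs_div, abs_of_pos hf]
  gcongr
  rw [div_le_iff₀ hf, abs_le]
  constructor <;> linarith
end Overlap

section Poisson

open Finset

open scoped Nat

/-- An approximate solution of the Poisson recursion `(k + 1) p (k + 1) = c p k` is close to the
exact one. -/
lemma exists_abs_sub_le_of_recursion (c : ℝ) (k : ℕ) : ∃ C : ℝ, 0 ≤ C ∧ ∀ (p : ℕ → ℝ) (δ : ℝ),
    (∀ i < k, |(i + 1 : ℝ) * p (i + 1) - c * p i| ≤ δ) →
    |p k - p 0 * (c ^ k / k !)| ≤ C * |δ| := by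
  induction k with
  | zero => exact ⟨0, le_rfl, fun p δ _ => by simp⟩
  | succ k ih =>
    obtain ⟨C, hC, h⟩ := ih
    refine ⟨1 + |c| * C, by positivity, fun p δ hp => ?_⟩
    have h1 := h p δ fun i hi => hp i (by omega)
    have h2 := (hp k (by omega)).trans (le_abs_self δ)
    have hk : (1 : ℝ) ≤ k + 1 := by linarith [k.cast_nonneg (α := ℝ)]
    have hsplit : (k + 1 : ℝ) * (p (k + 1) - p 0 * (c ^ (k + 1) / (k + 1)!)) =
        ((k + 1 : ℝ) * p (k + 1) - c * p k) + c * (p k - p 0 * (c ^ k / k !)) := by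
      rw [Nat.factorial_succ]
      push_cast
      field_simp
      ring
    calc |p (k + 1) - p 0 * (c ^ (k + 1) / (k + 1)!)|
        ≤ |(k + 1 : ℝ)| * |p (k + 1) - p 0 * (c ^ (k + 1) / (k + 1)!)| :=
          le_mul_of_one_le_left (abs_nonneg _) (hk.trans (le_abs_self _))
      _ ≤ |(k + 1 : ℝ) * p (k + 1) - c * p k| + |c| * |p k - p 0 * (c ^ k / k !)| := by
        rw [← abs_mul, ← abs_mul, hsplit]
        exact abs_add_le _ _
      _ ≤ |δ| + |c| * (C * |δ|) := by gcongr
      _ = _ := by ring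

lemma exists_abs_sum_sub_le_of_recursion (c : ℝ) (K : ℕ) :
    ∃ C : ℝ, 0 ≤ C ∧ ∀ (p : ℕ → ℝ) (δ : ℝ),
    (∀ i < K, |(i + 1 : ℝ) * p (i + 1) - c * p i| ≤ δ) →
    |∑ k ∈ range K, p k - p 0 * ∑ k ∈ range K, c ^ k / k !| ≤ C * |δ| := by
  choose C hC h using exists_abs_sub_le_of_recursion c
  refine ⟨∑ k ∈ range K, C k, sum_nonneg fun k _ => hC k, fun p δ hp => ?_⟩
  rw [mul_sum, ← sum_sub_distrib, sum_mul]
  refine (abs_sum_le_sum_abs _ _).trans (sum_le_sum fun k hk => h k p δ fun i hi => hp i ?_)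
  exact hi.trans (mem_range.1 hk)

lemma eventually_abs_sum_mul_exp_neg_sub_one_le (c : ℝ) {η : ℝ} (hη : 0 < η) :
    ∀ᶠ K in atTop, |(∑ k ∈ range K, c ^ k / k !) * Real.exp (-c) - 1| ≤ η := by
  have h : HasSum (fun k : ℕ => c ^ k / k !) (Real.exp c) := by
    rw [Real.exp_eq_exp_ℝ]
    exact NormedSpace.expSeries_div_hasSum_exp c
  have h2 := h.tendsto_sum_nat.mul_const (Real.exp (-c))
  rw [← Real.exp_add, add_neg_cancel, Real.exp_zero] at h2
  filter_upwards [Metric.tendsto_nhds.1 h2 η hη] with K hK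
  rw [Real.dist_eq] at hK
  exact hK.le

end Poisson

section TwoGraphs

open Finset Equiv

open scoped Nat Classical

variable {V : Type*} [Fintype V] [DecidableEq V] {G H : SimpleGraph V} {a b : ℕ}

lemma sum_card_permsWithOverlap (K : ℕ) :
    ∑ k ∈ range K, #(permsWithOverlap G H (2 * k)) = #{σ : Perm V | #(overlap G H σ) < 2 * K} := by
  rw [card_eq_sum_card_fiberwise (f := fun σ => #(overlap G H σ) / 2) (t := range K)]
  · refine sum_congr rfl fun k hk => ?_
    congr 1
    ext σ
    have h := even_iff_two_dvd.1 (even_card_overlap (G := G) (H := H) σ)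
    have := mem_range.1 hk
    simp only [permsWithOverlap, mem_filter, mem_univ, true_and]
    omega
  · intro σ hσ
    simp only [coe_filter, mem_univ, true_and, Set.mem_ofPred_eq, coe_range, Set.mem_Iio] at hσ ⊢
    omega

lemma abs_sum_card_permsWithOverlap_sub_one_le (hG : ∀ v, #{w | G.Adj v w} = a)
    (hH : ∀ v, #{w | H.Adj v w} = b) (hV : 2 ≤ Fintype.card V) {K : ℕ} (hK : 0 < K) :
    |∑ k ∈ range K, (#(permsWithOverlap G H (2 * k)) / (Fintype.card V)! : ℝ) - 1| ≤
      a * b / K := by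
  set n := Fintype.card V with hn
  have hsum : ∑ σ, #(overlap G H σ) ≤ 2 * (a * b) * n ! := by
    have h := sum_card_overlap_le hG hH
    rw [← hn] at h
    refine le_of_mul_le_mul_left (a := n - 1) ?_ (by omega)
    calc _ ≤ _ := h
      _ = n * (a * b * n !) := by ring
      _ ≤ (2 * (n - 1)) * (a * b * n !) := Nat.mul_le_mul_right _ (by omega)
      _ = _ := by ring
  have hmarkov : #{σ : Perm V | ¬ #(overlap G H σ) < 2 * K} * (2 * K) ≤ 2 * (a * b) * n ! := by
    refine le_trans ?_ hsum
    refine le_trans ?_ (sum_le_sum_of_subset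
      (subset_univ {σ : Perm V | ¬ #(overlap G H σ) < 2 * K}))
    rw [← smul_eq_mul]
    exact card_nsmul_le_sum _ _ _ fun σ hσ => not_lt.1 (mem_filter.1 hσ).2
  have htot := card_filter_add_card_filter_not (s := (univ : Finset (Perm V)))
    (fun σ => #(overlap G H σ) < 2 * K)
  rw [card_univ, Fintype.card_perm, ← hn, ← sum_card_permsWithOverlap] at htot
  set x := #{σ : Perm V | ¬ #(overlap G H σ) < 2 * K}
  have hf : (0 : ℝ) < (n ! : ℝ) := by exact_mod_cast n.factorial_pos
  have hK' : (0 : ℝ) < K := by exact_mod_cast hK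
  have htot' : ∑ k ∈ range K, (#(permsWithOverlap G H (2 * k)) : ℝ) = (n ! : ℝ) - x := by
    rw [← htot]; push_cast; ring
  have hmarkov' : (x * (2 * K) : ℝ) ≤ 2 * (a * b) * n ! := by exact_mod_cast hmarkov
  have : ∑ k ∈ range K, (#(permsWithOverlap G H (2 * k)) / n ! : ℝ) - 1 = -(x / n !) := by
    rw [← sum_div, htot']
    field_simp
    ring
  rw [this, abs_neg, abs_of_nonneg (by positivity), div_le_div_iff₀ hf hK']
  linarith

/-- The probability that a random relabelling of a `b`-regular graph `H` shares no edge with an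
`a`-regular graph `G` tends to `exp (-a b / 2)`, uniformly in `G` and `H`. -/
theorem exists_abs_card_permsWithOverlap_zero_sub_exp_le (a b : ℕ) {ε : ℝ} (hε : 0 < ε) :
    ∃ n₀ : ℕ, ∀ (V : Type) [Fintype V] [DecidableEq V] (G H : SimpleGraph V),
      (∀ v, #{w | G.Adj v w} = a) → (∀ v, #{w | H.Adj v w} = b) → n₀ ≤ Fintype.card V →
      |(#(permsWithOverlap G H 0) / (Fintype.card V)! : ℝ) - Real.exp (-(a * b / 2))| ≤ ε := by
  set c : ℝ := a * b / 2 with hc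
  have hc0 : 0 ≤ c := by positivity
  have hη : 0 < ε / 3 := by positivity
  have hev : ∀ᶠ K : ℕ in atTop, (a * b / K : ℝ) ≤ ε / 3 :=
    (tendsto_const_div_atTop_nhds_zero_nat (a * b : ℝ)).eventually_le_const hη
  obtain ⟨K, ⟨hK1, hK2⟩, hK⟩ := ((eventually_abs_sum_mul_exp_neg_sub_one_le c hη).and hev
    |>.and (eventually_gt_atTop 0)).exists
  obtain ⟨C, hC, hrec⟩ := exists_abs_sum_sub_le_of_recursion c K
  choose B hB using fun j => exists_abs_card_permsWithOverlap_le a b j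
  set B' : ℝ := ∑ k ∈ range K, (B (2 * k) : ℝ)
  have hlim := (tendsto_const_div_atTop_nhds_zero_nat (C * B')).eventually_le_const hη
  obtain ⟨n₀, hn₀⟩ := eventually_atTop.1 hlim
  refine ⟨max n₀ 4, fun V _ _ G H hG hH hV => ?_⟩
  have hV4 : 4 ≤ Fintype.card V := (le_max_right _ _).trans hV
  have h1 := hn₀ _ ((le_max_left _ _).trans hV)
  have h2 := abs_sum_card_permsWithOverlap_sub_one_le hG hH (by omega) hK
  have h3 := hrec (fun k => #(permsWithOverlap G H (2 * k)) / (Fintype.card V)!)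
    (B' / Fintype.card V) fun k hk => by
      have h := hB (2 * k) V G H hG hH hV4
      have hBk : (B (2 * k) : ℝ) ≤ B' :=
        single_le_sum (f := fun k => (B (2 * k) : ℝ)) (fun _ _ => Nat.cast_nonneg _)
          (mem_range.2 hk)
      have hBk' : (B (2 * k) / Fintype.card V : ℝ) ≤ B' / Fintype.card V := by gcongr
      have h0 := h.trans hBk'
      rw [show 2 * k + 2 = 2 * (k + 1) by ring, abs_le] at h0
      have hnn : (0 : ℝ) ≤ B' / Fintype.card V := by
        have : 0 ≤ B' := sum_nonneg fun _ _ => Nat.cast_nonneg _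
        positivity
      push_cast at h0
      rw [abs_le, hc]
      constructor <;> linarith [h0.1, h0.2]
  have hB0 : 0 ≤ B' := sum_nonneg fun _ _ => Nat.cast_nonneg _
  rw [abs_of_nonneg (by positivity : 0 ≤ B' / Fintype.card V), ← mul_div_assoc] at h3
  simp only [mul_zero] at h3
  set S := ∑ k ∈ range K, c ^ k / (k ! : ℝ)
  set P := ∑ k ∈ range K, (#(permsWithOverlap G H (2 * k)) / (Fintype.card V)! : ℝ)
  set p : ℝ := #(permsWithOverlap G H 0) / (Fintype.card V)!
  have hS : 1 ≤ S := by
    have := single_le_sum (f := fun k => c ^ k / (k ! : ℝ)) (fun _ _ => by positivity)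
      (mem_range.2 hK)
    simpa using this
  calc |p - Real.exp (-c)| ≤ S * |p - Real.exp (-c)| := le_mul_of_one_le_left (abs_nonneg _) hS
    _ = |(P - 1) - (P - p * S) - (S * Real.exp (-c) - 1)| := by
      rw [← abs_of_nonneg (zero_le_one.trans hS), ← abs_mul, abs_of_nonneg (zero_le_one.trans hS)]
      congr 1
      ring
    _ ≤ |P - 1| + |P - p * S| + |S * Real.exp (-c) - 1| :=
      (abs_sub _ _).trans (add_le_add_left (abs_sub _ _) _)
    _ ≤ ε / 3 + ε / 3 + ε / 3 := by
      gcongr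
      · exact h2.trans hK2
      · exact h3.trans h1
    _ = ε := by ring

end TwoGraphs

section ManyGraphs

open Finset Equiv

open scoped Nat Classical

lemma overlap_eq_empty_iff {V : Type*} [Fintype V] [DecidableEq V] {G H : SimpleGraph V}
    {σ : Perm V} : overlap G H σ = ∅ ↔ Disjoint (H.map σ) G := by
  rw [eq_empty_iff_forall_notMem, SimpleGraph.disjoint_left]
  simp only [Prod.forall, mem_overlap, SimpleGraph.map_adj']
  constructor
  · rintro h _ _ ⟨-, u, v, huv, rfl, rfl⟩ hG
    exact h u v ⟨huv, hG⟩
  · rintro h u v ⟨huv, hG⟩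
    exact h _ _ ⟨σ.injective.ne huv.ne, u, v, huv, rfl, rfl⟩ hG

lemma isRegularGraph_iff {n d : ℕ} {G : SimpleGraph (Fin n)} :
    IsRegularGraph G d ↔ ∀ v, #{w | G.Adj v w} = d := by
  simp only [IsRegularGraph, gDeg, Nat.card_eq_fintype_card, Fintype.card_subtype]

lemma IsRegularGraph.map {n d : ℕ} {G : SimpleGraph (Fin n)} (hG : IsRegularGraph G d)
    (σ : Perm (Fin n)) : IsRegularGraph (G.map σ.toEmbedding) d := by
  rw [isRegularGraph_iff] at hG ⊢
  intro v
  rw [← hG (σ.symm v)]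
  refine card_equiv σ.symm fun w => ?_
  have h := SimpleGraph.map_adj_apply (G := G) (f := σ.toEmbedding) (a := σ.symm v)
    (b := σ.symm w)
  simp only [coe_toEmbedding, apply_symm_apply] at h
  simpa using h

lemma IsRegularGraph.iSup {n : ℕ} {ι : Type*} [Fintype ι] {d : ι → ℕ}
    {G : ι → SimpleGraph (Fin n)} (hG : ∀ i, IsRegularGraph (G i) (d i))
    (h : ∀ i j, i ≠ j → Disjoint (G i) (G j)) : IsRegularGraph (⨆ i, G i) (∑ i, d i) := by
  rw [isRegularGraph_iff]
  intro v
  have : ({w | (⨆ i, G i).Adj v w} : Finset (Fin n)) =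
      univ.biUnion fun i => {w | (G i).Adj v w} := by
    ext w
    simp
  rw [this, card_biUnion]
  · exact sum_congr rfl fun i _ => isRegularGraph_iff.1 (hG i) v
  · intro i _ j _ hij
    refine disjoint_filter.2 fun w _ hi hj => ?_
    exact SimpleGraph.disjoint_left.1 (h i j hij) v w hi hj

lemma forall_disjoint_fin_succ_iff {α : Type*} [Order.Frame α] {m : ℕ} {f : Fin (m + 1) → α} :
    (∀ i j, i ≠ j → Disjoint (f i) (f j)) ↔
      (∀ i j : Fin m, i ≠ j → Disjoint (f i.succ) (f j.succ)) ∧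
        Disjoint (f 0) (⨆ i : Fin m, f i.succ) := by
  simp only [disjoint_iSup_iff, Fin.forall_fin_succ, ne_eq, not_true_eq_false, Fin.succ_inj,
    IsEmpty.forall_iff, true_and, (Fin.succ_ne_zero _), (Fin.succ_ne_zero _).symm,
    not_false_eq_true, forall_const]
  constructor
  · rintro ⟨h1, h2⟩
    exact ⟨fun i => (h2 i).2, h1⟩
  · rintro ⟨h1, h2⟩
    exact ⟨h2, fun i => ⟨(h2 i).symm, h1 i⟩⟩

lemma card_pairwise_disjoint_succ {n m : ℕ} (H : Fin (m + 1) → SimpleGraph (Fin n)) :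
    #{σ : Fin (m + 1) → Perm (Fin n) | ∀ i j, i ≠ j →
        Disjoint ((H i).map (σ i).toEmbedding) ((H j).map (σ j).toEmbedding)} =
      ∑ τ : Fin m → Perm (Fin n) with ∀ i j, i ≠ j →
        Disjoint ((H i.succ).map (τ i).toEmbedding) ((H j.succ).map (τ j).toEmbedding),
      #(permsWithOverlap (⨆ i, (H (Fin.succ i)).map (τ i).toEmbedding) (H 0) 0) := by
  rw [← card_sigma]
  refine card_nbij' (fun σ => ⟨Fin.tail σ, σ 0⟩) (fun x => Fin.cons x.2 x.1) ?_ ?_ ?_ ?_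
  · intro σ hσ
    simpa [permsWithOverlap, overlap_eq_empty_iff, Fin.tail, forall_disjoint_fin_succ_iff]
      using hσ
  · rintro ⟨τ, π⟩ h
    simpa [permsWithOverlap, overlap_eq_empty_iff, forall_disjoint_fin_succ_iff] using h
  · intro σ _
    simp
  · rintro ⟨τ, π⟩ _
    simp

theorem exists_abs_card_pairwise_disjoint_sub_exp_le (m : ℕ) : ∀ (d : Fin m → ℕ) (ε : ℝ), 0 < ε →
    ∃ n₀ : ℕ, ∀ n, n₀ ≤ n → ∀ H : (i : Fin m) → SimpleGraph (Fin n),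
      (∀ i, IsRegularGraph (H i) (d i)) →
      |(#{σ : Fin m → Perm (Fin n) | ∀ i j, i ≠ j →
          Disjoint ((H i).map (σ i).toEmbedding) ((H j).map (σ j).toEmbedding)} : ℝ) /
          (n ! : ℝ) ^ m -
        Real.exp (-((∑ i, ∑ j, if i < j then (d i * d j : ℝ) else 0) / 2))| ≤ ε := by
  induction m with
  | zero =>
    intro d ε hε
    exact ⟨0, fun n _ H _ => by simpa using hε.le⟩
  | succ m ih =>
    intro d ε hε
    set s : ℕ := ∑ i : Fin m, d i.succ with hs
    obtain ⟨n₁, h₁⟩ := ih (fun i => d i.succ) (ε / 2) (half_pos hε)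
    obtain ⟨n₂, h₂⟩ := exists_abs_card_permsWithOverlap_zero_sub_exp_le s (d 0) (half_pos hε)
    refine ⟨max n₁ n₂, fun n hn H hH => ?_⟩
    specialize h₁ n ((le_max_left _ _).trans hn) (fun i => H i.succ) fun i => hH i.succ
    rw [card_pairwise_disjoint_succ]
    set S : Finset (Fin m → Perm (Fin n)) := {τ | ∀ i j, i ≠ j →
      Disjoint ((H i.succ).map (τ i).toEmbedding) ((H j.succ).map (τ j).toEmbedding)}
    set D : ℝ := ∑ i : Fin m, ∑ j : Fin m, if i < j then (d i.succ * d j.succ : ℝ) else 0 with hD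
    have hsum : (∑ i, ∑ j, if i < j then (d i * d j : ℝ) else 0) = s * d 0 + D := by
      simp only [Fin.sum_univ_succ, Fin.succ_pos, Fin.not_lt_zero, Fin.succ_lt_succ_iff,
        if_true, if_false, zero_add, hs, hD]
      push_cast
      rw [sum_mul]
      simp only [mul_comm]
    set N : (Fin m → Perm (Fin n)) → ℝ := fun τ =>
      #(permsWithOverlap (⨆ i, (H (Fin.succ i)).map (τ i).toEmbedding) (H 0) 0) / (n ! : ℝ) with hN
    set e : ℝ := Real.exp (-(s * d 0 / 2))
    have h₂' : ∀ τ ∈ S, |N τ - e| ≤ ε / 2 := by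
      intro τ hτ
      have hreg := IsRegularGraph.iSup (fun i => (hH (Fin.succ i)).map (τ i)) (mem_filter.1 hτ).2
      have := h₂ (Fin n) _ _ (isRegularGraph_iff.1 hreg) (isRegularGraph_iff.1 (hH 0))
        (by simpa using (le_max_right _ _).trans hn)
      simpa [hN] using this
    have hf : (0 : ℝ) < (n ! : ℝ) := by exact_mod_cast n.factorial_pos
    have hSle : (#S / (n ! : ℝ) ^ m : ℝ) ≤ 1 := by
      rw [div_le_one (by positivity)]
      have := card_le_univ S
      simp only [Fintype.card_fun, Fintype.card_perm, Fintype.card_fin] at this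
      exact_mod_cast this
    have he : e ≤ 1 := Real.exp_le_one_iff.2 (by
      rw [neg_nonpos]
      positivity)
    have he0 : 0 ≤ e := (Real.exp_pos _).le
    have hexp : Real.exp (-((s * d 0 + D) / 2)) = e * Real.exp (-(D / 2)) := by
      rw [← Real.exp_add]
      congr 1
      ring
    have hsplit : (∑ τ ∈ S,
        #(permsWithOverlap (⨆ i, (H (Fin.succ i)).map (τ i).toEmbedding) (H 0) 0) : ℕ) /
          (n ! : ℝ) ^ (m + 1) - e * Real.exp (-(D / 2)) =
        (∑ τ ∈ S, (N τ - e)) / (n ! : ℝ) ^ m +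
          e * (#S / (n ! : ℝ) ^ m - Real.exp (-(D / 2))) := by
      rw [sum_sub_distrib, hN, ← sum_div, sum_const, nsmul_eq_mul]
      push_cast
      field_simp
      ring
    rw [hsum, hexp, hsplit]
    calc _ ≤ |(∑ τ ∈ S, (N τ - e)) / (n ! : ℝ) ^ m| +
          |e * (#S / (n ! : ℝ) ^ m - Real.exp (-(D / 2)))| := abs_add_le _ _
      _ ≤ ε / 2 + ε / 2 := by
        refine add_le_add ?_ ?_
        · rw [abs_div, abs_of_pos (by positivity : (0 : ℝ) < (n ! : ℝ) ^ m)]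
          calc _ ≤ (#S * (ε / 2)) / (n ! : ℝ) ^ m := by
                gcongr
                rw [← nsmul_eq_mul]
                exact (abs_sum_le_sum_abs _ _).trans (sum_le_card_nsmul _ _ _ h₂')
            _ = #S / (n ! : ℝ) ^ m * (ε / 2) := by ring
            _ ≤ _ := mul_le_of_le_one_left (by positivity) hSle
        · rw [abs_mul, abs_of_nonneg he0]
          exact (mul_le_of_le_one_left (abs_nonneg _) he).trans h₁
      _ = ε := add_halves ε

end ManyGraphs

open scoped Classical in
/-- Fix `m ≥ 2` and degrees `d_1, …, d_m ≥ 1`, and let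
`D = ∑_{k<ℓ} d_k d_ℓ`. For every `ε > 0` there is `n₀` such that for all `n ≥ n₀` and
all `d_i`-regular graphs `H_i` on `{1,…,n}`, if `σ_1, …, σ_m` are independent uniform
permutations, the probability that `σ_1(H_1), …, σ_m(H_m)` are pairwise edge-disjoint
is within `ε` of `exp(-D/2)`. -/
theorem statement_11 (m : ℕ) (hm : 2 ≤ m) (d : Fin m → ℕ) (hd : ∀ i, 1 ≤ d i) :
    ∀ ε : ℝ, 0 < ε → ∃ n₀ : ℕ, ∀ n, n₀ ≤ n →
      ∀ H : (i : Fin m) → SimpleGraph (Fin n),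
        (∀ i, IsRegularGraph (H i) (d i)) →
        |(Nat.card {σ : Fin m → Equiv.Perm (Fin n) //
              ∀ i j, i ≠ j →
                Disjoint ((H i).map (σ i).toEmbedding) ((H j).map (σ j).toEmbedding)} : ℝ) /
            (Nat.card (Fin m → Equiv.Perm (Fin n)) : ℝ) -
          Real.exp (-((∑ i, ∑ j, if i < j then (d i * d j : ℝ) else 0) / 2))| ≤ ε := by
  intro ε hε
  obtain ⟨n₀, h⟩ := exists_abs_card_pairwise_disjoint_sub_exp_le m d ε hε
  refine ⟨n₀, fun n hn H hH => ?_⟩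
  convert h n hn H hH using 4
  · rw [Nat.card_eq_fintype_card, Fintype.card_subtype]
  · simp [Nat.card_eq_fintype_card, Fintype.card_perm]
end

section
/- For each k ∈ {2,3,4} there exist a constant C_k > 0 and n0 ≥ 1 such that for every even n ≥ n0 and every integer d with 3 ≤ d ≤ n^{1/10}, if X denotes the number of triangles of a uniformly random d-regular graph G ~ μ_{d,n}, then |E[X^k] − E[X]^k − (k choose 2)·E[X]^{k−1}| ≤ C_k·E[X]^{k−2}. -/
open Filter Topology

/-- The number of triangles of `G`. -/
noncomputable def triCount {n : ℕ} (G : SimpleGraph (Fin n)) : ℕ :=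
  Nat.card {s : Finset (Fin n) // G.IsNClique 3 s}

section RandomRegular

open Finset
open scoped Classical

variable {V : Type*}

/-- The pairs `uv`, `xy` can be switched to `ux`, `vy` in `G`. -/
def Switchable (G : SimpleGraph V) (u v x y : V) : Prop :=
  G.Adj u v ∧ G.Adj x y ∧ ¬ G.Adj u x ∧ ¬ G.Adj v y ∧ u ≠ x ∧ v ≠ y

/-- The closed walk `u v y x` as a graph. -/
def switchCycle (u v x y : V) : SimpleGraph V :=
  (SimpleGraph.edge u v ⊔ SimpleGraph.edge x y) ⊔ (SimpleGraph.edge u x ⊔ SimpleGraph.edge v y)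

/-- The graph in which the pairs `uv`, `xy` have been switched with `ux`, `vy`. -/
def switchGraph (G : SimpleGraph V) (u v x y : V) : SimpleGraph V :=
  symmDiff G (switchCycle u v x y)

lemma switchCycle_swap (u v x y : V) : switchCycle u x v y = switchCycle u v x y := by
  unfold switchCycle
  rw [sup_comm]

lemma switchCycle_flip (u v x y : V) : switchCycle v u y x = switchCycle u v x y := by
  unfold switchCycle
  rw [SimpleGraph.edge_comm v u, SimpleGraph.edge_comm y x,
    sup_comm (SimpleGraph.edge v y)]

lemma switchCycle_rotate (u v x y : V) : switchCycle x y u v = switchCycle u v x y := by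
  unfold switchCycle
  rw [SimpleGraph.edge_comm x u, SimpleGraph.edge_comm y v,
    sup_comm (SimpleGraph.edge x y)]

lemma switchGraph_switchGraph (G : SimpleGraph V) (u v x y : V) :
    switchGraph (switchGraph G u v x y) u x v y = G := by
  unfold switchGraph
  rw [switchCycle_swap, symmDiff_symmDiff_cancel_right]

lemma switchGraph_adj (G : SimpleGraph V) (u v x y a b : V) :
    (switchGraph G u v x y).Adj a b ↔
      (G.Adj a b ∧ ¬ (switchCycle u v x y).Adj a b) ∨
      ((switchCycle u v x y).Adj a b ∧ ¬ G.Adj a b) := by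
  simp [switchGraph, symmDiff]

lemma switchCycle_adj (u v x y a b : V) :
    (switchCycle u v x y).Adj a b ↔ a ≠ b ∧
      (((a = u ∧ b = v) ∨ (a = v ∧ b = u)) ∨ ((a = x ∧ b = y) ∨ (a = y ∧ b = x)) ∨
      ((a = u ∧ b = x) ∨ (a = x ∧ b = u)) ∨ ((a = v ∧ b = y) ∨ (a = y ∧ b = v))) := by
  simp only [switchCycle, SimpleGraph.sup_adj, SimpleGraph.edge_adj]
  tauto

lemma Switchable.flip {G : SimpleGraph V} {u v x y : V} (h : Switchable G u v x y) :
    Switchable G v u y x := by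
  obtain ⟨h1, h2, h3, h4, h5, h6⟩ := h
  exact ⟨h1.symm, h2.symm, h4, h3, h6, h5⟩

lemma Switchable.rotate {G : SimpleGraph V} {u v x y : V} (h : Switchable G u v x y) :
    Switchable G x y u v := by
  obtain ⟨h1, h2, h3, h4, h5, h6⟩ := h
  exact ⟨h2, h1, fun h => h3 h.symm, fun h => h4 h.symm, h5.symm, h6.symm⟩

lemma Switchable.switchGraph {G : SimpleGraph V} {u v x y : V} (h : Switchable G u v x y) :
    Switchable (switchGraph G u v x y) u x v y := by
  obtain ⟨h1, h2, h3, h4, h5, h6⟩ := h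
  have h7 := h1.ne
  have h8 := h2.ne
  refine ⟨?_, ?_, ?_, ?_, h7, h8⟩ <;> rw [switchGraph_adj, switchCycle_adj] <;> tauto

lemma le_switchGraph {G H : SimpleGraph V} {u v x y : V} (hH : H ≤ G)
    (huv : ¬ H.Adj u v) (hxy : ¬ H.Adj x y) (h : Switchable G u v x y) :
    H ≤ switchGraph G u v x y := by
  obtain ⟨-, -, h3, h4, -⟩ := h
  intro a b hab
  rw [switchGraph_adj, switchCycle_adj]
  refine Or.inl ⟨hH hab, ?_⟩
  rintro ⟨-, (⟨rfl, rfl⟩ | ⟨rfl, rfl⟩) | (⟨rfl, rfl⟩ | ⟨rfl, rfl⟩) | (⟨rfl, rfl⟩ | ⟨rfl, rfl⟩) |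
    (⟨rfl, rfl⟩ | ⟨rfl, rfl⟩)⟩
  · exact huv hab
  · exact huv hab.symm
  · exact hxy hab
  · exact hxy hab.symm
  · exact h3 (hH hab)
  · exact h3 (hH hab.symm)
  · exact h4 (hH hab)
  · exact h4 (hH hab.symm)

/-- The complete graph on the vertices in `T`. -/
def completeOn (T : Finset V) : SimpleGraph V where
  Adj x y := x ∈ T ∧ y ∈ T ∧ x ≠ y
  symm := ⟨fun _ _ h => ⟨h.2.1, h.1, h.2.2.symm⟩⟩
  loopless := ⟨fun _ h => h.2.2 rfl⟩

lemma completeOn_triple {a b c : V} :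
    completeOn {a, b, c} =
      SimpleGraph.edge a b ⊔ SimpleGraph.edge b c ⊔ SimpleGraph.edge a c := by
  ext x y
  simp only [completeOn, mem_insert, mem_singleton, SimpleGraph.sup_adj, SimpleGraph.edge_adj]
  by_cases h : x = y
  · simp [h]
  · have h1 : x = a → ¬ y = a := fun e e' => h (e.trans e'.symm)
    have h2 : x = b → ¬ y = b := fun e e' => h (e.trans e'.symm)
    have h3 : x = c → ¬ y = c := fun e e' => h (e.trans e'.symm)
    tauto

lemma sup_completeOn_adj {L : Finset (Finset V)} {x y : V} :
    (L.sup completeOn).Adj x y ↔ ∃ T ∈ L, (completeOn T).Adj x y := by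
  induction L using Finset.induction_on with
  | empty => simp
  | insert T L _ ih => simp [sup_insert, ih]

lemma mem_biUnion_of_adj {L : Finset (Finset V)} {x y : V} (h : (L.sup completeOn).Adj x y) :
    x ∈ L.biUnion id := by
  obtain ⟨T, hT, hxy⟩ := sup_completeOn_adj.1 h
  exact mem_biUnion.2 ⟨T, hT, hxy.1⟩

variable [Fintype V]

/-- The number of neighbours of `v` in `G`. -/
noncomputable def nbrCard (G : SimpleGraph V) (v : V) : ℕ :=
  (univ.filter fun w => G.Adj v w).card

/-- The number of ordered pairs of adjacent vertices of `G`. -/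
noncomputable def arcCard (G : SimpleGraph V) : ℕ :=
  (univ.filter fun p : V × V => G.Adj p.1 p.2).card

/-- The `d`-regular graphs containing `H`. -/
noncomputable def regAbove (d : ℕ) (H : SimpleGraph V) : Finset (SimpleGraph V) :=
  univ.filter fun G => H ≤ G ∧ ∀ v, nbrCard G v = d

/-- The number of `d`-regular graphs containing `H`, as a real number. -/
noncomputable def regCount (d : ℕ) (H : SimpleGraph V) : ℝ := ((regAbove d H).card : ℝ)

lemma nbrCard_switchGraph_left {G : SimpleGraph V} {u v x y : V} (h : Switchable G u v x y) :
    nbrCard (switchGraph G u v x y) u = nbrCard G u := by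
  obtain ⟨h1, h2, h3, h4, h5, h6⟩ := h
  have h7 := h1.ne
  have h8 := h2.ne
  have huy : u ≠ y := by rintro rfl; exact h4 h1.symm
  have hvx : v ≠ x := by rintro rfl; exact h3 h1
  have key : (univ.filter fun w => (switchGraph G u v x y).Adj u w) =
      insert x ((univ.filter fun w => G.Adj u w).erase v) := by
    ext w
    simp only [mem_filter, mem_univ, true_and, mem_insert, mem_erase]
    rw [switchGraph_adj, switchCycle_adj]
    constructor
    · rintro (⟨a, b⟩ | ⟨⟨a, b⟩, c⟩)
      · by_cases hwx : w = x
        · exact Or.inl hwx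
        · refine Or.inr ⟨?_, a⟩
          rintro rfl
          exact b ⟨h7, by simp⟩
      · simp only [huy, h7, h5, true_and, false_and, false_or, or_false] at b
        rcases b with rfl | rfl
        · exact absurd h1 c
        · exact Or.inl rfl
    · rintro (rfl | ⟨a, b⟩)
      · exact Or.inr ⟨⟨h5, by simp⟩, h3⟩
      · refine Or.inl ⟨b, ?_⟩
        rintro ⟨-, c⟩
        simp only [huy, h7, h5, true_and, false_and, false_or, or_false] at c
        rcases c with rfl | rfl
        · exact a rfl
        · exact h3 b
  unfold nbrCard
  rw [key, card_insert_of_notMem, card_erase_add_one]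
  · simpa using h1
  · simp [h3]

lemma nbrCard_switchGraph {G : SimpleGraph V} {u v x y : V} (h : Switchable G u v x y) (w : V) :
    nbrCard (switchGraph G u v x y) w = nbrCard G w := by
  by_cases h1 : w = u
  · subst h1; exact nbrCard_switchGraph_left h
  by_cases h2 : w = v
  · subst h2
    have := nbrCard_switchGraph_left h.flip
    unfold switchGraph at this ⊢
    rwa [switchCycle_flip] at this
  by_cases h3 : w = x
  · subst h3
    have := nbrCard_switchGraph_left h.rotate
    unfold switchGraph at this ⊢
    rwa [switchCycle_rotate] at this
  by_cases h4 : w = y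
  · subst h4
    have := nbrCard_switchGraph_left h.flip.rotate
    unfold switchGraph at this ⊢
    rwa [switchCycle_rotate, switchCycle_flip] at this
  unfold nbrCard
  congr 1
  ext z
  simp only [mem_filter, mem_univ, true_and]
  rw [switchGraph_adj, switchCycle_adj]
  tauto

lemma mem_regAbove {d : ℕ} {H G : SimpleGraph V} :
    G ∈ regAbove d H ↔ H ≤ G ∧ ∀ v, nbrCard G v = d := by
  simp [regAbove]

lemma regAbove_sup_edge {d : ℕ} {H : SimpleGraph V} {u v : V} (huv : u ≠ v) :
    regAbove d (H ⊔ SimpleGraph.edge u v) = (regAbove d H).filter fun G => G.Adj u v := by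
  ext G
  simp only [mem_filter, mem_regAbove, sup_le_iff, SimpleGraph.edge_le_iff, huv, false_or]
  tauto

/-- Double counting of the switchings that remove the edge `uv`. -/
lemma sum_card_switchable {d : ℕ} {H : SimpleGraph V} {u v : V} (huv : u ≠ v)
    (hH : ¬ H.Adj u v) :
    ∑ G ∈ regAbove d (H ⊔ SimpleGraph.edge u v),
      (univ.filter fun p : V × V => Switchable G u v p.1 p.2 ∧ ¬ H.Adj p.1 p.2).card =
    ∑ G ∈ regAbove d H,
      (univ.filter fun p : V × V => Switchable G u p.1 v p.2 ∧ ¬ H.Adj u p.1 ∧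
        ¬ H.Adj v p.2).card := by
  rw [← card_sigma, ← card_sigma]
  refine card_nbij' (fun q => ⟨switchGraph q.1 u v q.2.1 q.2.2, q.2⟩)
    (fun q => ⟨switchGraph q.1 u q.2.1 v q.2.2, q.2⟩) ?_ ?_ ?_ ?_
  · rintro ⟨G, x, y⟩ hq
    simp only [coe_sigma, Set.mem_sigma_iff, mem_coe, mem_filter, mem_univ, true_and,
      regAbove_sup_edge huv, mem_regAbove] at hq ⊢
    obtain ⟨⟨⟨hG, hd⟩, -⟩, hs, hxy⟩ := hq
    exact ⟨⟨le_switchGraph hG hH hxy hs, fun w => (nbrCard_switchGraph hs w).trans (hd w)⟩,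
      hs.switchGraph, fun h => hs.2.2.1 (hG h), fun h => hs.2.2.2.1 (hG h)⟩
  · rintro ⟨G, x, y⟩ hq
    simp only [coe_sigma, Set.mem_sigma_iff, mem_coe, mem_filter, mem_univ, true_and,
      regAbove_sup_edge huv, mem_regAbove] at hq ⊢
    obtain ⟨⟨hG, hd⟩, hs, hux, hvy⟩ := hq
    exact ⟨⟨⟨le_switchGraph hG hux hvy hs, fun w => (nbrCard_switchGraph hs w).trans (hd w)⟩,
      hs.switchGraph.1⟩, hs.switchGraph, fun h => hs.2.2.2.1 (hG h)⟩
  · rintro ⟨G, x, y⟩ -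
    simp [switchGraph_switchGraph]
  · rintro ⟨G, x, y⟩ -
    simp [switchGraph_switchGraph]

lemma card_arcs_from (G : SimpleGraph V) (S : Finset V) :
    (univ.filter fun p : V × V => p.1 ∈ S ∧ G.Adj p.1 p.2).card = ∑ x ∈ S, nbrCard G x := by
  unfold nbrCard
  rw [← card_sigma]
  refine card_nbij' (fun p => ⟨p.1, p.2⟩) (fun q => (q.1, q.2)) ?_ ?_ ?_ ?_
  · rintro ⟨x, y⟩ h
    simpa using h
  · rintro ⟨x, y⟩ h
    simpa using h
  · rintro ⟨x, y⟩ -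
    rfl
  · rintro ⟨x, y⟩ -
    rfl

lemma card_arcs_to (G : SimpleGraph V) (S : Finset V) :
    (univ.filter fun p : V × V => p.2 ∈ S ∧ G.Adj p.1 p.2).card = ∑ x ∈ S, nbrCard G x := by
  rw [← card_arcs_from]
  refine card_nbij' Prod.swap Prod.swap ?_ ?_ ?_ ?_
  · rintro ⟨x, y⟩ h
    simpa [G.adj_comm] using h
  · rintro ⟨x, y⟩ h
    simpa [G.adj_comm] using h
  · rintro ⟨x, y⟩ -
    rfl
  · rintro ⟨x, y⟩ -
    rfl

lemma arcCard_eq_sum (G : SimpleGraph V) : arcCard G = ∑ x, nbrCard G x := by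
  rw [← card_arcs_from]
  simp [arcCard]

lemma arcCard_of_mem {d : ℕ} {H G : SimpleGraph V} (hG : G ∈ regAbove d H) :
    arcCard G = Fintype.card V * d := by
  rw [arcCard_eq_sum, sum_congr rfl fun x _ => (mem_regAbove.1 hG).2 x]
  simp

lemma sum_nbrCard_closed_nbhd {d : ℕ} {H G : SimpleGraph V} (hG : G ∈ regAbove d H) (u : V) :
    ∑ x ∈ insert u (univ.filter fun w => G.Adj u w), nbrCard G x = (d + 1) * d := by
  have hd := (mem_regAbove.1 hG).2
  rw [sum_congr rfl fun x _ => hd x, sum_const, card_insert_of_notMem (by simp), smul_eq_mul]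
  congr 2
  exact hd u

lemma card_switchable_ge {d : ℕ} {H G : SimpleGraph V} (hG : G ∈ regAbove d H) {u v : V}
    (huv : G.Adj u v) :
    Fintype.card V * d ≤
      (univ.filter fun p : V × V => Switchable G u v p.1 p.2 ∧ ¬ H.Adj p.1 p.2).card +
        arcCard H + 2 * ((d + 1) * d) := by
  rw [← arcCard_of_mem hG, two_mul]
  nth_rewrite 1 [← sum_nbrCard_closed_nbhd hG u]
  rw [← sum_nbrCard_closed_nbhd hG v, ← card_arcs_from, ← card_arcs_to]
  unfold arcCard
  rw [← add_assoc]
  refine le_trans ?_ (le_trans (card_union_le _ _) (Nat.add_le_add_right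
    (le_trans (card_union_le _ _) (Nat.add_le_add_right (card_union_le _ _) _)) _))
  refine card_le_card ?_
  rintro ⟨x, y⟩ h
  simp only [mem_filter, mem_univ, true_and, mem_union, mem_insert] at h ⊢
  unfold Switchable
  have e1 : u = x ↔ x = u := eq_comm
  have e2 : v = y ↔ y = v := eq_comm
  rw [ne_eq, ne_eq, e1, e2]
  tauto

lemma card_switchable_le {d : ℕ} {H G : SimpleGraph V} (hG : G ∈ regAbove d H) (u v : V) :
    (univ.filter fun p : V × V => Switchable G u v p.1 p.2 ∧ ¬ H.Adj p.1 p.2).card ≤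
      Fintype.card V * d := by
  rw [← arcCard_of_mem hG]
  refine card_le_card ?_
  rintro ⟨x, y⟩ h
  simp only [mem_filter, mem_univ, true_and] at h ⊢
  exact h.1.2.1

lemma card_new_nbrs {d : ℕ} {H G : SimpleGraph V} (hG : G ∈ regAbove d H) (u : V) :
    ((univ.filter fun x => G.Adj u x ∧ ¬ H.Adj u x).card : ℝ) = d - nbrCard H u := by
  obtain ⟨hH, hd⟩ := mem_regAbove.1 hG
  rw [eq_sub_iff_add_eq, ← hd u]
  unfold nbrCard
  rw [← Nat.cast_add, ← card_union_of_disjoint]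
  · congr 2
    ext x
    simp only [mem_union, mem_filter, mem_univ, true_and]
    have := @hH u x
    tauto
  · rw [disjoint_filter]
    tauto

lemma card_new_nbr_pairs {d : ℕ} {H G : SimpleGraph V} (hG : G ∈ regAbove d H) (u v : V) :
    ((univ.filter fun p : V × V => (G.Adj u p.1 ∧ ¬ H.Adj u p.1) ∧
      (G.Adj v p.2 ∧ ¬ H.Adj v p.2)).card : ℝ) = (d - nbrCard H u) * (d - nbrCard H v) := by
  rw [← card_new_nbrs hG, ← card_new_nbrs hG, ← Nat.cast_mul, ← card_product]
  congr 2
  ext ⟨x, y⟩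
  simp

lemma regCount_nonneg (d : ℕ) (H : SimpleGraph V) : 0 ≤ regCount d H := Nat.cast_nonneg _

lemma regCount_anti {d : ℕ} {H K : SimpleGraph V} (h : H ≤ K) : regCount d K ≤ regCount d H := by
  unfold regCount
  refine Nat.cast_le.2 (card_le_card ?_)
  intro G hG
  rw [mem_regAbove] at hG ⊢
  exact ⟨h.trans hG.1, hG.2⟩

/-- Upper bound for the number of regular graphs containing an additional edge. -/
lemma regCount_sup_edge_mul_le {d : ℕ} (hd : 3 ≤ d) {H : SimpleGraph V} (hm : arcCard H ≤ 40)
    {u v : V} (huv : u ≠ v) (hH : ¬ H.Adj u v) :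
    regCount d (H ⊔ SimpleGraph.edge u v) * (Fintype.card V * d - 8 * d ^ 2) ≤
      (d - nbrCard H u) * (d - nbrCard H v) * regCount d H := by
  have key := congrArg (Nat.cast : ℕ → ℝ) (sum_card_switchable (d := d) huv hH)
  push_cast at key
  have h1 : regCount d (H ⊔ SimpleGraph.edge u v) * (Fintype.card V * d - 8 * d ^ 2) ≤
      ∑ G ∈ regAbove d (H ⊔ SimpleGraph.edge u v),
      ((univ.filter fun p : V × V =>
        Switchable G u v p.1 p.2 ∧ ¬ H.Adj p.1 p.2).card : ℝ) := by
    unfold regCount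
    rw [← nsmul_eq_mul]
    refine card_nsmul_le_sum _ _ _ fun G hG => ?_
    rw [regAbove_sup_edge huv, mem_filter] at hG
    have h2 := card_switchable_ge hG.1 hG.2
    have h3 : (Fintype.card V * d : ℝ) ≤
      ((univ.filter fun p : V × V => Switchable G u v p.1 p.2 ∧ ¬ H.Adj p.1 p.2).card : ℝ) +
        arcCard H + 2 * ((d + 1) * d) := by exact_mod_cast h2
    have h4 : (arcCard H : ℝ) ≤ 40 := by exact_mod_cast hm
    have h5 : (3 : ℝ) ≤ d := by exact_mod_cast hd
    nlinarith
  have h2 : ∑ G ∈ regAbove d H,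
      ((univ.filter fun p : V × V => Switchable G u p.1 v p.2 ∧ ¬ H.Adj u p.1 ∧
        ¬ H.Adj v p.2).card : ℝ) ≤ (d - nbrCard H u) * (d - nbrCard H v) * regCount d H := by
    unfold regCount
    rw [mul_comm, ← nsmul_eq_mul]
    refine sum_le_card_nsmul _ _ _ fun G hG => ?_
    rw [← card_new_nbr_pairs hG]
    refine Nat.cast_le.2 (card_le_card ?_)
    rintro ⟨x, y⟩ h
    simp only [mem_filter, mem_univ, true_and] at h ⊢
    exact ⟨⟨h.1.1, h.2.1⟩, h.1.2.1, h.2.2⟩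
  linarith

lemma nbrCard_le {d : ℕ} {H G : SimpleGraph V} (hG : G ∈ regAbove d H) (u : V) :
    nbrCard H u ≤ d := by
  obtain ⟨hH, hd⟩ := mem_regAbove.1 hG
  rw [← hd u]
  refine card_le_card ?_
  intro x hx
  simp only [mem_filter, mem_univ, true_and] at hx ⊢
  exact hH hx

lemma regCount_sup_edge_le {d : ℕ} (hd : 3 ≤ d) (hn : 16 * d ≤ Fintype.card V)
    {H : SimpleGraph V} (hm : arcCard H ≤ 40) {u v : V} (huv : u ≠ v) (hH : ¬ H.Adj u v) :
    regCount d (H ⊔ SimpleGraph.edge u v) ≤ 2 * d / Fintype.card V * regCount d H := by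
  have hd' : (3 : ℝ) ≤ d := by exact_mod_cast hd
  have hn' : (16 * d : ℝ) ≤ Fintype.card V := by exact_mod_cast hn
  have hnpos : (0 : ℝ) < Fintype.card V := by linarith
  rw [div_mul_eq_mul_div, le_div_iff₀ hnpos]
  have h0 := regCount_nonneg d H
  have h1 := regCount_nonneg d (H ⊔ SimpleGraph.edge u v)
  have key := regCount_sup_edge_mul_le hd hm huv hH
  have h2 : ((d : ℝ) - nbrCard H u) * (d - nbrCard H v) * regCount d H ≤
      d ^ 2 * regCount d H := by
    rcases (regAbove d H).eq_empty_or_nonempty with he | ⟨G, hG⟩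
    · simp [regCount, he]
    · have hu : (nbrCard H u : ℝ) ≤ d := by exact_mod_cast nbrCard_le hG u
      have hv : (nbrCard H v : ℝ) ≤ d := by exact_mod_cast nbrCard_le hG v
      have hu0 : (0 : ℝ) ≤ nbrCard H u := Nat.cast_nonneg _
      have hv0 : (0 : ℝ) ≤ nbrCard H v := Nat.cast_nonneg _
      refine mul_le_mul_of_nonneg_right ?_ h0
      nlinarith
  have h3 : regCount d (H ⊔ SimpleGraph.edge u v) * (Fintype.card V * d / 2) ≤
      regCount d (H ⊔ SimpleGraph.edge u v) * (Fintype.card V * d - 8 * d ^ 2) := by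
    refine mul_le_mul_of_nonneg_left ?_ h1
    nlinarith
  have h4 : (d : ℝ) * (regCount d (H ⊔ SimpleGraph.edge u v) * Fintype.card V) ≤
      d * (2 * d * regCount d H) := by nlinarith
  exact le_of_mul_le_mul_left h4 (by linarith)

lemma arcCard_sup_le (H K : SimpleGraph V) : arcCard (H ⊔ K) ≤ arcCard H + arcCard K := by
  refine le_trans (card_le_card ?_) (card_union_le _ _)
  rintro ⟨x, y⟩ h
  simpa using h

lemma arcCard_edge_le (a b : V) : arcCard (SimpleGraph.edge a b) ≤ 2 := by
  refine le_trans (card_le_card (t := {(a, b), (b, a)}) ?_) card_le_two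
  rintro ⟨x, y⟩ h
  simp only [mem_filter, mem_univ, true_and, SimpleGraph.edge_adj] at h
  simp only [mem_insert, mem_singleton, Prod.mk.injEq]
  exact h.1

lemma arcCard_sup_edge_le (H : SimpleGraph V) (a b : V) :
    arcCard (H ⊔ SimpleGraph.edge a b) ≤ arcCard H + 2 :=
  (arcCard_sup_le _ _).trans (Nat.add_le_add_left (arcCard_edge_le _ _) _)

lemma card_filter_adj_le {d : ℕ} (hd : 3 ≤ d) (hn : 16 * d ≤ Fintype.card V)
    {H : SimpleGraph V} (hm : arcCard H ≤ 40) {u v : V} (hH : ¬ H.Adj u v) :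
    (((regAbove d H).filter fun G => G.Adj u v).card : ℝ) ≤
      2 * d / Fintype.card V * regCount d H := by
  by_cases huv : u = v
  · subst huv
    simp only [SimpleGraph.irrefl, filter_false, card_empty, Nat.cast_zero]
    exact mul_nonneg (by positivity) (regCount_nonneg _ _)
  · rw [← regAbove_sup_edge huv]
    exact regCount_sup_edge_le hd hn hm huv hH

lemma card_filter_adj_adj_le {d : ℕ} (hd : 3 ≤ d) (hn : 16 * d ≤ Fintype.card V)
    {H : SimpleGraph V} (hm : arcCard H ≤ 38) {a b u v : V} (hab : ¬ H.Adj a b)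
    (huv : ¬ H.Adj u v) (hne : ¬ (u = a ∧ v = b ∨ u = b ∧ v = a)) :
    (((regAbove d H).filter fun G => G.Adj a b ∧ G.Adj u v).card : ℝ) ≤
      (2 * d / Fintype.card V) ^ 2 * regCount d H := by
  have hp : (0 : ℝ) ≤ 2 * d / Fintype.card V := by positivity
  by_cases h : a = b
  · subst h
    simp only [SimpleGraph.irrefl, false_and, filter_false, card_empty, Nat.cast_zero]
    exact mul_nonneg (by positivity) (regCount_nonneg _ _)
  · rw [← filter_filter, ← regAbove_sup_edge h]
    refine (card_filter_adj_le hd hn ((arcCard_sup_edge_le H a b).trans (by omega)) ?_).trans ?_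
    · rw [SimpleGraph.sup_adj, SimpleGraph.edge_adj]
      tauto
    · rw [pow_two, mul_assoc]
      exact mul_le_mul_of_nonneg_left (regCount_sup_edge_le hd hn (by omega) h hab) hp

lemma card_filter_adj_adj_adj_le {d : ℕ} (hd : 3 ≤ d) (hn : 16 * d ≤ Fintype.card V)
    {H : SimpleGraph V} (hm : arcCard H ≤ 36) {a b u v x y : V} (hab : ¬ H.Adj a b)
    (huv : ¬ H.Adj u v) (hne : ¬ (u = a ∧ v = b ∨ u = b ∧ v = a))
    (hxy : ¬ (x = a ∧ y = b ∨ x = b ∧ y = a)) (hxy' : ¬ (x = u ∧ y = v ∨ x = v ∧ y = u)) :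
    (((regAbove d H).filter fun G => G.Adj a b ∧ G.Adj u v ∧ G.Adj x y).card : ℝ) ≤
      (2 * d / Fintype.card V) ^ 2 *
        (2 * d / Fintype.card V + if H.Adj x y then 1 else 0) * regCount d H := by
  have hp : (0 : ℝ) ≤ 2 * d / Fintype.card V := by positivity
  have h0 := regCount_nonneg d H
  split_ifs with hH
  · refine le_trans (Nat.cast_le.2 (card_le_card ?_)) ((card_filter_adj_adj_le hd hn
      (by omega) hab huv hne).trans ?_)
    · intro G
      simp only [mem_filter]
      tauto
    · refine mul_le_mul_of_nonneg_right ?_ h0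
      nlinarith [sq_nonneg (2 * (d : ℝ) / Fintype.card V)]
  · by_cases h : a = b
    · subst h
      simp only [SimpleGraph.irrefl, false_and, filter_false, card_empty, Nat.cast_zero]
      exact mul_nonneg (by positivity) h0
    · rw [← filter_filter, ← regAbove_sup_edge h, add_zero]
      refine (card_filter_adj_adj_le hd hn ((arcCard_sup_edge_le H a b).trans (by omega))
        ?_ ?_ hxy').trans ?_
      · rw [SimpleGraph.sup_adj, SimpleGraph.edge_adj]
        tauto
      · rw [SimpleGraph.sup_adj, SimpleGraph.edge_adj]
        tauto
      · rw [mul_assoc]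
        exact mul_le_mul_of_nonneg_left (regCount_sup_edge_le hd hn (by omega) h hab)
          (by positivity)

lemma sum_card_filter_comm {α β : Type*} (s : Finset α) (t : Finset β) (P : α → β → Prop)
    [∀ a b, Decidable (P a b)] :
    ∑ a ∈ s, ((t.filter fun b => P a b).card : ℝ) =
      ∑ b ∈ t, ((s.filter fun a => P a b).card : ℝ) := by
  simp only [card_filter, Nat.cast_sum]
  exact sum_comm

/-- Pairs of new neighbours of `u` and `v` joined by an edge are rare. -/
lemma sum_card_adjacent_new_nbrs_le {d : ℕ} (hd : 3 ≤ d) (hn : 16 * d ≤ Fintype.card V)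
    {H : SimpleGraph V} (hm : arcCard H ≤ 36) {u v : V} (huv : u ≠ v) :
    ∑ G ∈ regAbove d H, ((univ.filter fun p : V × V => ((G.Adj u p.1 ∧ ¬ H.Adj u p.1) ∧
      (G.Adj v p.2 ∧ ¬ H.Adj v p.2)) ∧ ¬ G.Adj u v ∧ G.Adj p.1 p.2).card : ℝ) ≤
    (2 * d / Fintype.card V) ^ 2 * (Fintype.card V ^ 2 * (2 * d / Fintype.card V) + arcCard H) *
      regCount d H := by
  rw [sum_card_filter_comm]
  have h0 := regCount_nonneg d H
  calc _ ≤ ∑ p : V × V, (2 * d / Fintype.card V : ℝ) ^ 2 *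
        (2 * d / Fintype.card V + if H.Adj p.1 p.2 then 1 else 0) * regCount d H := by
        refine sum_le_sum fun p _ => ?_
        obtain ⟨x, y⟩ := p
        dsimp only
        by_cases hgood : ¬ H.Adj u x ∧ ¬ H.Adj v y ∧ x ≠ v ∧ y ≠ u
        · obtain ⟨h1, h2, h3, h4⟩ := hgood
          refine le_trans (Nat.cast_le.2 (card_le_card ?_)) (card_filter_adj_adj_adj_le hd hn hm
            h1 h2 ?_ ?_ ?_)
          · intro G
            simp only [mem_filter]
            tauto
          · rintro (⟨rfl, -⟩ | ⟨rfl, -⟩)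
            · exact huv rfl
            · exact h3 rfl
          · rintro (⟨h, h'⟩ | ⟨-, h⟩)
            · exact h4 (h'.trans h)
            · exact h4 h
          · rintro (⟨h, -⟩ | ⟨rfl, rfl⟩)
            · exact h3 h
            · simp_all
        · rw [filter_false_of_mem, card_empty, Nat.cast_zero]
          · split_ifs <;> positivity
          · rintro G hG ⟨⟨⟨h1, h2⟩, h3, h4⟩, h5, h6⟩
            refine hgood ⟨h2, h4, ?_, ?_⟩
            · rintro rfl
              exact h5 h1
            · rintro rfl
              exact h5 h3.symm
    _ = _ := by
        rw [← sum_mul, ← mul_sum, sum_add_distrib, sum_boole]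
        simp only [sum_const, card_univ, Fintype.card_prod, nsmul_eq_mul, arcCard]
        push_cast
        ring

/-- Common new neighbours of `u` and `v` are rare. -/
lemma sum_card_common_new_nbrs_le {d : ℕ} (hd : 3 ≤ d) (hn : 16 * d ≤ Fintype.card V)
    {H : SimpleGraph V} (hm : arcCard H ≤ 38) {u v : V} (huv : u ≠ v) :
    ∑ G ∈ regAbove d H, ((univ.filter fun x : V => (G.Adj u x ∧ ¬ H.Adj u x) ∧
      (G.Adj v x ∧ ¬ H.Adj v x)).card : ℝ) ≤
    Fintype.card V * ((2 * d / Fintype.card V) ^ 2 * regCount d H) := by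
  rw [sum_card_filter_comm, ← nsmul_eq_mul, ← card_univ]
  refine sum_le_card_nsmul _ _ _ fun x _ => ?_
  have h0 := regCount_nonneg d H
  by_cases hgood : ¬ H.Adj u x ∧ ¬ H.Adj v x ∧ x ≠ u ∧ x ≠ v
  · obtain ⟨h1, h2, h3, h4⟩ := hgood
    refine le_trans (Nat.cast_le.2 (card_le_card ?_)) (card_filter_adj_adj_le hd hn hm
      h1 h2 ?_)
    · intro G
      simp only [mem_filter]
      tauto
    · rintro (⟨rfl, -⟩ | ⟨rfl, -⟩)
      · exact huv rfl
      · exact h4 rfl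
  · rw [filter_false_of_mem, card_empty, Nat.cast_zero]
    · rw [card_univ]; positivity
    · rintro G hG ⟨⟨h1, h2⟩, h3, h4⟩
      exact hgood ⟨h2, h4, h1.ne', h3.ne'⟩

/-- Lower bound for the number of regular graphs containing an additional edge. -/
lemma le_regCount_sup_edge {d : ℕ} (hd : 3 ≤ d) (hn : 16 * d ≤ Fintype.card V)
    (hn' : 200 ≤ Fintype.card V) {H : SimpleGraph V} (hm : arcCard H ≤ 36)
    {u v : V} (huv : u ≠ v) (hH : ¬ H.Adj u v) :
    (d - nbrCard H u) * (d - nbrCard H v) * regCount d H ≤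
      regCount d (H ⊔ SimpleGraph.edge u v) * (Fintype.card V * d + d ^ 2) +
        11 * d ^ 3 / Fintype.card V * regCount d H := by
  have key := congrArg (Nat.cast : ℕ → ℝ) (sum_card_switchable (d := d) huv hH)
  push_cast at key
  have h0 := regCount_nonneg d H
  have h1 : ∑ G ∈ regAbove d (H ⊔ SimpleGraph.edge u v),
      ((univ.filter fun p : V × V =>
        Switchable G u v p.1 p.2 ∧ ¬ H.Adj p.1 p.2).card : ℝ) ≤
      regCount d (H ⊔ SimpleGraph.edge u v) * (Fintype.card V * d) := by
    unfold regCount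
    rw [← nsmul_eq_mul]
    refine sum_le_card_nsmul _ _ _ fun G hG => ?_
    rw [regAbove_sup_edge huv, mem_filter] at hG
    exact_mod_cast card_switchable_le hG.1 u v
  have h2 : (d - nbrCard H u) * (d - nbrCard H v) * regCount d H ≤
      ∑ G ∈ regAbove d H,
      (((univ.filter fun p : V × V => Switchable G u p.1 v p.2 ∧ ¬ H.Adj u p.1 ∧
        ¬ H.Adj v p.2).card : ℝ) + (if G.Adj u v then (d ^ 2 : ℝ) else 0) +
        ((univ.filter fun p : V × V => ((G.Adj u p.1 ∧ ¬ H.Adj u p.1) ∧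
          (G.Adj v p.2 ∧ ¬ H.Adj v p.2)) ∧ ¬ G.Adj u v ∧ G.Adj p.1 p.2).card : ℝ) +
        ((univ.filter fun x : V => (G.Adj u x ∧ ¬ H.Adj u x) ∧
          (G.Adj v x ∧ ¬ H.Adj v x)).card : ℝ)) := by
    unfold regCount
    rw [mul_comm, ← nsmul_eq_mul]
    refine card_nsmul_le_sum _ _ _ fun G hG => ?_
    split_ifs with hG'
    · have hu : (nbrCard H u : ℝ) ≤ d := by exact_mod_cast nbrCard_le hG u
      have hv : (nbrCard H v : ℝ) ≤ d := by exact_mod_cast nbrCard_le hG v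
      have hu0 : (0 : ℝ) ≤ nbrCard H u := Nat.cast_nonneg _
      have hv0 : (0 : ℝ) ≤ nbrCard H v := Nat.cast_nonneg _
      have : ((d : ℝ) - nbrCard H u) * (d - nbrCard H v) ≤ d ^ 2 := by nlinarith
      refine this.trans ?_
      rw [add_assoc, add_assoc, add_left_comm]
      exact le_add_of_nonneg_right (by positivity)
    · rw [← card_new_nbr_pairs hG, add_zero]
      have hdiag : (univ.filter fun x : V => (G.Adj u x ∧ ¬ H.Adj u x) ∧
          (G.Adj v x ∧ ¬ H.Adj v x)).card = ((univ.filter fun x : V => (G.Adj u x ∧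
          ¬ H.Adj u x) ∧ (G.Adj v x ∧ ¬ H.Adj v x)).image fun x => (x, x)).card :=
        (card_image_of_injective _ fun a b h => (Prod.mk.inj h).1).symm
      rw [hdiag]
      have := le_trans (card_le_card (s := univ.filter fun p : V × V =>
        (G.Adj u p.1 ∧ ¬ H.Adj u p.1) ∧ (G.Adj v p.2 ∧ ¬ H.Adj v p.2)) ?_)
        (le_trans (card_union_le _ _) (Nat.add_le_add_right (card_union_le
        (univ.filter fun p : V × V => Switchable G u p.1 v p.2 ∧ ¬ H.Adj u p.1 ∧
          ¬ H.Adj v p.2)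
        (univ.filter fun p : V × V => ((G.Adj u p.1 ∧ ¬ H.Adj u p.1) ∧
          (G.Adj v p.2 ∧ ¬ H.Adj v p.2)) ∧ ¬ G.Adj u v ∧ G.Adj p.1 p.2))
        ((univ.filter fun x : V => (G.Adj u x ∧ ¬ H.Adj u x) ∧
          (G.Adj v x ∧ ¬ H.Adj v x)).image fun x => (x, x)).card))
      · exact_mod_cast this
      · rintro ⟨x, y⟩ h
        simp only [mem_filter, mem_univ, true_and, mem_union, mem_image, Prod.mk.injEq] at h ⊢
        by_cases hxy : x = y
        · subst hxy
          exact Or.inr ⟨x, h, rfl, rfl⟩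
        · left
          unfold Switchable
          tauto
  rw [sum_add_distrib, sum_add_distrib, sum_add_distrib, ← key, ← sum_filter,
    ← regAbove_sup_edge huv, sum_const, nsmul_eq_mul] at h2
  have h3 := sum_card_adjacent_new_nbrs_le hd hn hm huv
  have h4 := sum_card_common_new_nbrs_le hd hn (hm.trans (by norm_num)) huv
  have h5 : (2 * d / Fintype.card V : ℝ) ^ 2 *
      (Fintype.card V ^ 2 * (2 * d / Fintype.card V) + arcCard H) * regCount d H +
      Fintype.card V * ((2 * d / Fintype.card V) ^ 2 * regCount d H) ≤
      11 * d ^ 3 / Fintype.card V * regCount d H := by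
    have hN : (200 : ℝ) ≤ Fintype.card V := by exact_mod_cast hn'
    have hD : (3 : ℝ) ≤ d := by exact_mod_cast hd
    have hM : (arcCard H : ℝ) ≤ 36 := by exact_mod_cast hm
    have hN0 : (0 : ℝ) < Fintype.card V := by linarith
    rw [← mul_assoc, ← add_mul]
    refine mul_le_mul_of_nonneg_right ?_ h0
    rw [le_div_iff₀ hN0]
    have e : ((2 * d / Fintype.card V : ℝ) ^ 2 *
      (Fintype.card V ^ 2 * (2 * d / Fintype.card V) + arcCard H) +
      Fintype.card V * (2 * d / Fintype.card V) ^ 2) * Fintype.card V =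
      8 * d ^ 3 + 4 * d ^ 2 * (arcCard H / Fintype.card V) + 4 * d ^ 2 := by
      field_simp
      ring
    rw [e]
    have h6 : (arcCard H : ℝ) / Fintype.card V ≤ 1 := by
      rw [div_le_one hN0]; linarith
    have h7 : (d : ℝ) ^ 2 * 3 ≤ d ^ 3 := by nlinarith [sq_nonneg (d : ℝ)]
    have h8 : (d : ℝ) ^ 2 * (arcCard H / Fintype.card V) ≤ d ^ 2 * 1 :=
      mul_le_mul_of_nonneg_left h6 (sq_nonneg _)
    nlinarith
  have h6 : (#(regAbove d (H ⊔ SimpleGraph.edge u v)) : ℝ) =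
    regCount d (H ⊔ SimpleGraph.edge u v) := rfl
  rw [h6] at h2
  linarith

lemma regCount_sup_edge_le_of_nbrCard_le_one {d : ℕ} (hd : 3 ≤ d)
    (hn : 16 * d ≤ Fintype.card V) {H : SimpleGraph V} (hm : arcCard H ≤ 36) {u v : V}
    (huv : u ≠ v) (hH : ¬ H.Adj u v) (hu : nbrCard H u ≤ 1) (hv : nbrCard H v ≤ 1) :
    regCount d (H ⊔ SimpleGraph.edge u v) ≤ (1 + 30 * d / Fintype.card V) *
      ((d - nbrCard H u) * (d - nbrCard H v) / (Fintype.card V * d)) * regCount d H := by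
  have key := regCount_sup_edge_mul_le hd (hm.trans (by norm_num)) huv hH
  have h0 := regCount_nonneg d H
  have h1 := regCount_nonneg d (H ⊔ SimpleGraph.edge u v)
  have hD : (3 : ℝ) ≤ d := by exact_mod_cast hd
  have hN : (16 * d : ℝ) ≤ Fintype.card V := by exact_mod_cast hn
  have hN0 : (0 : ℝ) < Fintype.card V := by linarith
  have hu' : (nbrCard H u : ℝ) ≤ 1 := by exact_mod_cast hu
  have hv' : (nbrCard H v : ℝ) ≤ 1 := by exact_mod_cast hv
  set N' := regCount d (H ⊔ SimpleGraph.edge u v)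
  set N := regCount d H
  set n : ℝ := (Fintype.card V : ℝ)
  set D : ℝ := (d : ℝ)
  set α : ℝ := (D - nbrCard H u) * (D - nbrCard H v)
  have e : (1 + 30 * D / n) * (α / (n * D)) * N = ((1 + 30 * D / n) * (α * N)) / (n * D) := by
    ring
  rw [e, le_div_iff₀ (by positivity)]
  have h2 : n * D ≤ (1 + 30 * D / n) * (n * D - 8 * D ^ 2) := by
    have : (1 + 30 * D / n) * (n * D - 8 * D ^ 2) =
        n * D + D ^ 2 * (22 - 240 * (D / n)) := by
      field_simp
      ring
    rw [this]
    have h3 : D / n ≤ 1 / 16 := by rw [div_le_iff₀ hN0]; linarith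
    have : 0 ≤ D ^ 2 * (22 - 240 * (D / n)) := mul_nonneg (sq_nonneg _) (by linarith)
    linarith
  calc N' * (n * D) ≤ N' * ((1 + 30 * D / n) * (n * D - 8 * D ^ 2)) :=
        mul_le_mul_of_nonneg_left h2 h1
    _ = (1 + 30 * D / n) * (N' * (n * D - 8 * D ^ 2)) := by ring
    _ ≤ _ := mul_le_mul_of_nonneg_left key (by positivity)

lemma le_regCount_sup_edge_of_nbrCard_le_one {d : ℕ} (hd : 3 ≤ d)
    (hn : 16 * d ≤ Fintype.card V) (hn' : 200 ≤ Fintype.card V) {H : SimpleGraph V}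
    (hm : arcCard H ≤ 36) {u v : V}
    (huv : u ≠ v) (hH : ¬ H.Adj u v) (hu : nbrCard H u ≤ 1) (hv : nbrCard H v ≤ 1) :
    (1 - 30 * d / Fintype.card V) *
      ((d - nbrCard H u) * (d - nbrCard H v) / (Fintype.card V * d)) * regCount d H ≤
      regCount d (H ⊔ SimpleGraph.edge u v) := by
  have key := le_regCount_sup_edge hd hn hn' hm huv hH
  have h0 := regCount_nonneg d H
  have h1 := regCount_nonneg d (H ⊔ SimpleGraph.edge u v)
  have hD : (3 : ℝ) ≤ d := by exact_mod_cast hd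
  have hN : (16 * d : ℝ) ≤ Fintype.card V := by exact_mod_cast hn
  have hN0 : (0 : ℝ) < Fintype.card V := by linarith
  have hu' : (nbrCard H u : ℝ) ≤ 1 := by exact_mod_cast hu
  have hv' : (nbrCard H v : ℝ) ≤ 1 := by exact_mod_cast hv
  set N' := regCount d (H ⊔ SimpleGraph.edge u v)
  set N := regCount d H
  set n : ℝ := (Fintype.card V : ℝ)
  set D : ℝ := (d : ℝ)
  set α : ℝ := (D - nbrCard H u) * (D - nbrCard H v) with hα
  have hα' : 4 / 9 * D ^ 2 ≤ α := by
    have h2 : 2 / 3 * D ≤ D - nbrCard H u := by linarith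
    have h3 : 2 / 3 * D ≤ D - nbrCard H v := by linarith
    calc 4 / 9 * D ^ 2 = (2 / 3 * D) * (2 / 3 * D) := by ring
      _ ≤ α := mul_le_mul h2 h3 (by positivity) (by linarith)
  have e : (1 - 30 * D / n) * (α / (n * D)) * N = ((1 - 30 * D / n) * (α * N)) / (n * D) := by
    ring
  rw [e, div_le_iff₀ (by positivity)]
  set t := D / n with ht
  have ht0 : 0 ≤ t := by positivity
  have hDn : D = t * n := by rw [ht]; field_simp
  have e2 : 30 * D / n = 30 * t := by rw [ht]; ring
  have e3 : 11 * D ^ 3 / n = 11 * t * D ^ 2 := by rw [ht]; ring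
  have e4 : n * D + D ^ 2 = n * D * (1 + t) := by rw [ht]; field_simp
  rw [e3, e4] at key
  rw [e2]
  have h4 : 11 * t * D ^ 2 * N ≤ 99 / 4 * t * α * N := by
    refine mul_le_mul_of_nonneg_right ?_ h0
    nlinarith
  have hαN : 0 ≤ α * N := mul_nonneg (by nlinarith) h0
  have h5 : (1 + t) * ((1 - 30 * t) * (α * N)) ≤ (1 + t) * (N' * (n * D)) := by
    have : (1 + t) * ((1 - 30 * t) * (α * N)) ≤ (1 - 99 / 4 * t) * (α * N) := by
      rw [← mul_assoc]
      refine mul_le_mul_of_nonneg_right ?_ hαN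
      nlinarith
    nlinarith
  exact le_of_mul_le_mul_left h5 (by linarith)

lemma nbrCard_sup_edge_of_isolated {H : SimpleGraph V} {a b : V} (hab : a ≠ b)
    (ha : ∀ w, ¬ H.Adj a w) : nbrCard (H ⊔ SimpleGraph.edge a b) a = 1 := by
  unfold nbrCard
  rw [card_eq_one]
  refine ⟨b, ?_⟩
  ext w
  simp only [mem_filter, mem_univ, true_and, mem_singleton, SimpleGraph.sup_adj, ha,
    SimpleGraph.edge_adj, false_or]
  constructor
  · rintro ⟨h | ⟨h, -⟩, -⟩
    · exact h
    · exact absurd h hab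
  · rintro rfl
    exact ⟨Or.inl rfl, hab⟩

lemma nbrCard_sup_edge_of_ne {H : SimpleGraph V} {a b c : V} (hac : c ≠ a) (hbc : c ≠ b) :
    nbrCard (H ⊔ SimpleGraph.edge a b) c = nbrCard H c := by
  unfold nbrCard
  congr 1
  ext w
  simp only [mem_filter, mem_univ, true_and, SimpleGraph.sup_adj, SimpleGraph.edge_adj]
  tauto

/-- The number of regular graphs containing a triangle on isolated vertices of `H`. -/
lemma abs_regCount_sup_triangle_sub_le {d : ℕ} (hd : 3 ≤ d) (hn : 30 * d ≤ Fintype.card V)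
    (hn' : 200 ≤ Fintype.card V) {H : SimpleGraph V} (hm : arcCard H ≤ 30) {T : Finset V}
    (hT : T.card = 3) (hiso : ∀ a ∈ T, ∀ w, ¬ H.Adj a w) :
    |regCount d (H ⊔ completeOn T) - ((d - 1) ^ 3 / Fintype.card V ^ 3) * regCount d H| ≤
      210 * d / Fintype.card V * (((d - 1) ^ 3 / Fintype.card V ^ 3) * regCount d H) := by
  obtain ⟨a, b, c, hab, hac, hbc, rfl⟩ := card_eq_three.1 hT
  have ha := hiso a (by simp)
  have hb := hiso b (by simp)
  have hc := hiso c (by simp)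
  have hn16 : 16 * d ≤ Fintype.card V := by omega
  have zero_of {x : V} (hx : ∀ w, ¬ H.Adj x w) : nbrCard H x = 0 := by
    simp [nbrCard, hx]
  rw [completeOn_triple, ← sup_assoc, ← sup_assoc]
  set H₁ := H ⊔ SimpleGraph.edge a b with hH₁
  set H₂ := H₁ ⊔ SimpleGraph.edge b c with hH₂
  have a0 : nbrCard H a = 0 := zero_of ha
  have b0 : nbrCard H b = 0 := zero_of hb
  have b1 : nbrCard H₁ b = 1 := by
    rw [hH₁, SimpleGraph.edge_comm]
    exact nbrCard_sup_edge_of_isolated hab.symm hb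
  have c1 : nbrCard H₁ c = 0 := by
    rw [hH₁, nbrCard_sup_edge_of_ne hac.symm hbc.symm, zero_of hc]
  have a2 : nbrCard H₂ a = 1 := by
    rw [hH₂, nbrCard_sup_edge_of_ne hab hac, hH₁]
    exact nbrCard_sup_edge_of_isolated hab ha
  have c2 : nbrCard H₂ c = 1 := by
    rw [hH₂, SimpleGraph.edge_comm]
    refine nbrCard_sup_edge_of_isolated hbc.symm fun w => ?_
    rw [hH₁, SimpleGraph.sup_adj, SimpleGraph.edge_adj]
    have := hc w
    have := hac.symm
    have := hbc.symm
    tauto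
  have n1 : ¬ H₁.Adj b c := by
    rw [hH₁, SimpleGraph.sup_adj, SimpleGraph.edge_adj]
    have := hb c
    have := hac.symm
    have := hbc.symm
    tauto
  have n2 : ¬ H₂.Adj a c := by
    rw [hH₂, SimpleGraph.sup_adj, SimpleGraph.edge_adj, hH₁, SimpleGraph.sup_adj,
      SimpleGraph.edge_adj]
    have := ha c
    have := hac.symm
    have := hbc.symm
    tauto
  have m1 : arcCard H₁ ≤ 32 := (arcCard_sup_edge_le H a b).trans (by omega)
  have m2 : arcCard H₂ ≤ 34 := (arcCard_sup_edge_le H₁ b c).trans (by omega)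
  have U0 := regCount_sup_edge_le_of_nbrCard_le_one hd hn16 (hm.trans (by norm_num)) hab (ha b)
    (by omega) (by omega)
  have U1 := regCount_sup_edge_le_of_nbrCard_le_one hd hn16 (m1.trans (by norm_num)) hbc n1
    (by omega) (by omega)
  have U2 := regCount_sup_edge_le_of_nbrCard_le_one hd hn16 (m2.trans (by norm_num)) hac n2
    (by omega) (by omega)
  have L0 := le_regCount_sup_edge_of_nbrCard_le_one hd hn16 hn' (hm.trans (by norm_num)) hab
    (ha b) (by omega) (by omega)
  have L1 := le_regCount_sup_edge_of_nbrCard_le_one hd hn16 hn' (m1.trans (by norm_num)) hbc n1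
    (by omega) (by omega)
  have L2 := le_regCount_sup_edge_of_nbrCard_le_one hd hn16 hn' (m2.trans (by norm_num)) hac n2
    (by omega) (by omega)
  rw [← hH₁] at U0 L0
  rw [← hH₂] at U1 L1
  rw [a0, b0] at U0 L0
  rw [b1, c1] at U1 L1
  rw [a2, c2] at U2 L2
  have hN : (30 * d : ℝ) ≤ Fintype.card V := by exact_mod_cast hn
  have hD : (3 : ℝ) ≤ d := by exact_mod_cast hd
  have h0 := regCount_nonneg d H
  set N₀ := regCount d H
  set N₁ := regCount d H₁
  set N₂ := regCount d H₂
  set N₃ := regCount d (H₂ ⊔ SimpleGraph.edge a c)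
  set n : ℝ := (Fintype.card V : ℝ)
  set D : ℝ := (d : ℝ)
  have hN0 : 0 < n := by linarith
  set ε := 30 * D / n with hε
  have hε0 : 0 ≤ ε := by positivity
  have hε1 : ε ≤ 1 := by rw [hε, div_le_one hN0]; exact hN
  have hε' : 210 * D / n = 7 * ε := by rw [hε]; ring
  have hD1 : 0 ≤ D - 1 := by linarith
  push_cast at U0 U1 U2 L0 L1 L2
  rw [sub_zero] at U0 L0 U1 L1
  set q₀ := D * D / (n * D)
  set q₁ := (D - 1) * D / (n * D)
  set q₂ := (D - 1) * (D - 1) / (n * D)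
  have hq0 : 0 ≤ q₀ := by positivity
  have hq1 : 0 ≤ q₁ := by positivity
  have hq2 : 0 ≤ q₂ := by positivity
  have hq : (D - 1) ^ 3 / n ^ 3 = q₀ * q₁ * q₂ := by
    simp only [q₀, q₁, q₂]
    field_simp
  have Q0 : 0 ≤ q₀ * q₁ * q₂ * N₀ := by positivity
  rw [hq, hε', abs_le]
  have hU : N₃ ≤ (1 + ε) ^ 3 * (q₀ * q₁ * q₂ * N₀) := by
    calc N₃ ≤ (1 + ε) * q₂ * N₂ := U2
      _ ≤ (1 + ε) * q₂ * ((1 + ε) * q₁ * N₁) := mul_le_mul_of_nonneg_left U1 (by positivity)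
      _ ≤ (1 + ε) * q₂ * ((1 + ε) * q₁ * ((1 + ε) * q₀ * N₀)) :=
        mul_le_mul_of_nonneg_left (mul_le_mul_of_nonneg_left U0 (by positivity)) (by positivity)
      _ = _ := by ring
  have hε2 : 0 ≤ 1 - ε := by linarith
  have hL : (1 - ε) ^ 3 * (q₀ * q₁ * q₂ * N₀) ≤ N₃ := by
    calc (1 - ε) ^ 3 * (q₀ * q₁ * q₂ * N₀)
        = (1 - ε) * q₂ * ((1 - ε) * q₁ * ((1 - ε) * q₀ * N₀)) := by ring
      _ ≤ (1 - ε) * q₂ * ((1 - ε) * q₁ * N₁) :=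
        mul_le_mul_of_nonneg_left (mul_le_mul_of_nonneg_left L0 (by positivity)) (by positivity)
      _ ≤ (1 - ε) * q₂ * N₂ := mul_le_mul_of_nonneg_left L1 (by positivity)
      _ ≤ N₃ := L2
  have h3 : (1 + ε) ^ 3 ≤ 1 + 7 * ε := by nlinarith [mul_nonneg hε0 hε2]
  have h4 : 1 - 7 * ε ≤ (1 - ε) ^ 3 := by nlinarith [mul_nonneg hε0 hε2]
  have h5 := mul_le_mul_of_nonneg_right h3 Q0
  have h6 := mul_le_mul_of_nonneg_right h4 Q0
  constructor <;> nlinarith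

lemma card_triples_avoiding_bounds {W : Finset V} (hW : W.card ≤ 9)
    (hn' : 200 ≤ Fintype.card V) :
    ((Fintype.card V : ℝ) ^ 3 - 33 * Fintype.card V ^ 2) / 6 ≤
        ((powersetCard 3 (univ \ W)).card : ℝ) ∧
      ((powersetCard 3 (univ \ W)).card : ℝ) ≤ (Fintype.card V : ℝ) ^ 3 / 6 := by
  have hc : (univ \ W).card = Fintype.card V - W.card := by
    rw [card_sdiff_of_subset (subset_univ _), card_univ]
  rw [card_powersetCard, hc]
  set n := Fintype.card V
  have h1 : (n - W.card).descFactorial 3 = 6 * (n - W.card).choose 3 := by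
    rw [Nat.descFactorial_eq_factorial_mul_choose]
    rfl
  have h2 : (n - W.card).descFactorial 3 ≤ n ^ 3 :=
    (Nat.descFactorial_le_pow _ _).trans (Nat.pow_le_pow_left (Nat.sub_le _ _) 3)
  have h3 : (n - 11) ^ 3 ≤ (n - W.card).descFactorial 3 :=
    (Nat.pow_le_pow_left (by omega) 3).trans (Nat.pow_sub_le_descFactorial _ _)
  rw [h1] at h2 h3
  have h4 : ((n : ℝ) - 11) ^ 3 ≤ 6 * ((n - W.card).choose 3 : ℝ) := by
    have : (((n - 11 : ℕ) : ℝ)) ^ 3 ≤ 6 * ((n - W.card).choose 3 : ℝ) := by exact_mod_cast h3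
    rwa [Nat.cast_sub (by omega)] at this
  have h5 : 6 * ((n - W.card).choose 3 : ℝ) ≤ (n : ℝ) ^ 3 := by exact_mod_cast h2
  have hN : (200 : ℝ) ≤ n := by exact_mod_cast hn'
  constructor
  · nlinarith
  · linarith

/-- The total count over triangles avoiding the vertices of `H`. -/
lemma abs_sum_regCount_avoiding_sub_le {d : ℕ} (hd : 3 ≤ d) (hn : 30 * d ≤ Fintype.card V)
    (hn' : 200 ≤ Fintype.card V) {H : SimpleGraph V} (hm : arcCard H ≤ 30) {W : Finset V}
    (hW : W.card ≤ 9) (hHW : ∀ a b, H.Adj a b → a ∈ W) :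
    |∑ T ∈ powersetCard 3 (univ \ W), regCount d (H ⊔ completeOn T) -
        ((d - 1) ^ 3 / 6) * regCount d H| ≤
      221 * d / Fintype.card V * (((d - 1) ^ 3 / 6) * regCount d H) := by
  have hsum : |∑ T ∈ powersetCard 3 (univ \ W), (regCount d (H ⊔ completeOn T) -
      ((d - 1) ^ 3 / Fintype.card V ^ 3) * regCount d H)| ≤
      (powersetCard 3 (univ \ W)).card * (210 * d / Fintype.card V *
        (((d - 1) ^ 3 / Fintype.card V ^ 3) * regCount d H)) := by
    refine (abs_sum_le_sum_abs _ _).trans ?_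
    rw [← nsmul_eq_mul]
    refine sum_le_card_nsmul _ _ _ fun T hT => ?_
    rw [mem_powersetCard] at hT
    refine abs_regCount_sup_triangle_sub_le hd hn hn' hm hT.2 fun a ha w hw => ?_
    exact (mem_sdiff.1 (hT.1 ha)).2 (hHW a w hw)
  rw [sum_sub_distrib, sum_const, nsmul_eq_mul] at hsum
  obtain ⟨hc1, hc2⟩ := card_triples_avoiding_bounds hW hn'
  have h0 := regCount_nonneg d H
  have hD : (3 : ℝ) ≤ d := by exact_mod_cast hd
  have hN : (200 : ℝ) ≤ Fintype.card V := by exact_mod_cast hn'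
  set N := regCount d H
  set n : ℝ := (Fintype.card V : ℝ)
  set D : ℝ := (d : ℝ)
  set c : ℝ := ((powersetCard 3 (univ \ W)).card : ℝ)
  set S := ∑ T ∈ powersetCard 3 (univ \ W), regCount d (H ⊔ completeOn T)
  have hN0 : 0 < n := by linarith
  have hD1 : 0 ≤ D - 1 := by linarith
  set A := (D - 1) ^ 3 / n ^ 3 * N with hA
  have hA0 : 0 ≤ A := by positivity
  have e1 : (D - 1) ^ 3 / 6 * N = n ^ 3 / 6 * A := by rw [hA]; field_simp
  have hc3 : c * (210 * D / n * A) ≤ n ^ 3 / 6 * (210 * D / n * A) :=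
    mul_le_mul_of_nonneg_right hc2 (by positivity)
  have hc4 : |c * A - n ^ 3 / 6 * A| ≤ 11 * D / n * (n ^ 3 / 6 * A) := by
    rw [← sub_mul, abs_mul, abs_of_nonneg hA0, ← mul_assoc (11 * D / n)]
    refine mul_le_mul_of_nonneg_right ?_ hA0
    have e2 : 11 * D / n * (n ^ 3 / 6) = 11 * D * n ^ 2 / 6 := by field_simp
    rw [e2, abs_le]
    constructor
    · nlinarith [sq_nonneg n]
    · have : 0 ≤ 11 * D * n ^ 2 / 6 := by positivity
      linarith
  rw [e1]
  calc |S - n ^ 3 / 6 * A| = |(S - c * A) + (c * A - n ^ 3 / 6 * A)| := by ring_nf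
    _ ≤ |S - c * A| + |c * A - n ^ 3 / 6 * A| := abs_add_le _ _
    _ ≤ n ^ 3 / 6 * (210 * D / n * A) + 11 * D / n * (n ^ 3 / 6 * A) := by linarith
    _ = _ := by ring

lemma regCount_sup_triangle_le {d : ℕ} (hd : 3 ≤ d) (hn : 16 * d ≤ Fintype.card V)
    {H : SimpleGraph V} (hm : arcCard H ≤ 30) {W : Finset V}
    (hHW : ∀ a b, H.Adj a b → a ∈ W) {a b c : V} (hab : a ≠ b) (hac : a ≠ c) (hbc : b ≠ c)
    (hT : ¬ completeOn {a, b, c} ≤ H) :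
    regCount d (H ⊔ completeOn {a, b, c}) ≤
      2 * d / Fintype.card V * ((if b ∈ W then (1 : ℝ) else 2 * d / Fintype.card V) *
        (if c ∈ W then (1 : ℝ) else 2 * d / Fintype.card V)) * regCount d H := by
  have hp : (0 : ℝ) ≤ 2 * d / Fintype.card V := by positivity
  set p : ℝ := 2 * d / Fintype.card V with hpdef
  have hHW' : ∀ a b, H.Adj a b → b ∈ W := fun a b h => hHW b a h.symm
  have two {x y z : V} (hxy : x ≠ y) (hyz : y ≠ z) (hxz : x ≠ z) (hy : y ∉ W) :
      regCount d (H ⊔ SimpleGraph.edge x y ⊔ SimpleGraph.edge y z) ≤ p * (p * regCount d H) := by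
    refine (regCount_sup_edge_le hd hn ((arcCard_sup_edge_le H x y).trans (by omega)) hyz
      ?_).trans (mul_le_mul_of_nonneg_left (regCount_sup_edge_le hd hn (by omega) hxy
        fun h => hy (hHW' _ _ h)) hp)
    rw [SimpleGraph.sup_adj, SimpleGraph.edge_adj]
    have := fun h => hy (hHW y z h)
    have := hxz.symm
    tauto
  by_cases hb : b ∈ W
  · by_cases hc : c ∈ W
    · rw [if_pos hb, if_pos hc, mul_one, mul_one]
      have : ∃ x y, (completeOn {a, b, c}).Adj x y ∧ ¬ H.Adj x y := by
        by_contra! h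
        exact hT fun x y hxy => h x y hxy
      obtain ⟨x, y, hxy, hH⟩ := this
      refine (regCount_anti (sup_le_sup_left ?_ H)).trans
        (regCount_sup_edge_le hd hn (by omega) hxy.ne hH)
      exact (SimpleGraph.edge_le_iff _).2 (Or.inr hxy)
    · rw [if_pos hb, if_neg hc, one_mul, mul_assoc]
      refine (regCount_anti ?_).trans (two hac hbc.symm hab hc)
      rw [completeOn_triple, SimpleGraph.edge_comm c b, sup_assoc]
      refine sup_le_sup_left (sup_le le_sup_right ?_) _
      exact le_sup_right.trans le_sup_left
  · by_cases hc : c ∈ W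
    · rw [if_pos hc, if_neg hb, mul_one, mul_assoc]
      refine (regCount_anti ?_).trans (two hab hbc hac hb)
      rw [completeOn_triple, sup_assoc]
      exact sup_le_sup_left le_sup_left _
    · rw [if_neg hb, if_neg hc, completeOn_triple, ← sup_assoc, ← sup_assoc]
      have h2 := mul_le_mul_of_nonneg_left (two hab hbc hac hb) hp
      refine (regCount_sup_edge_le hd hn ((arcCard_sup_edge_le _ b c).trans
        ((Nat.add_le_add_right (arcCard_sup_edge_le H a b) 2).trans (by omega))) hac
        ?_).trans (h2.trans_eq (by ring))
      rw [SimpleGraph.sup_adj, SimpleGraph.edge_adj, SimpleGraph.sup_adj, SimpleGraph.edge_adj]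
      have := fun h => hc (hHW' a c h)
      have := hac.symm
      have := hbc.symm
      tauto

/-- The total count over new triangles meeting the vertices of `H`. -/
lemma sum_regCount_meeting_le {d : ℕ} (hd : 3 ≤ d) (hn : 16 * d ≤ Fintype.card V)
    {H : SimpleGraph V} (hm : arcCard H ≤ 30) {W : Finset V} (hW : W.card ≤ 9)
    (hHW : ∀ a b, H.Adj a b → a ∈ W) :
    ∑ T ∈ (powersetCard 3 univ).filter fun T : Finset V =>
        ¬ Disjoint T W ∧ ¬ completeOn T ≤ H, regCount d (H ⊔ completeOn T) ≤
      450 * d ^ 3 / Fintype.card V * regCount d H := by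
  set p : ℝ := 2 * d / Fintype.card V with hpdef
  have hp : (0 : ℝ) ≤ p := by positivity
  have h0 := regCount_nonneg d H
  set g : V → ℝ := fun x => if x ∈ W then 1 else p with hg
  have hg0 : ∀ x, 0 ≤ g x := by
    intro x
    simp only [hg]
    split_ifs
    · exact zero_le_one
    · exact hp
  have hsel : ∀ T ∈ (powersetCard 3 univ).filter fun T : Finset V =>
      ¬ Disjoint T W ∧ ¬ completeOn T ≤ H, ∃ t : V × V × V, t.1 ∈ W ∧ T = {t.1, t.2.1, t.2.2} ∧
        regCount d (H ⊔ completeOn T) ≤ p * (g t.2.1 * g t.2.2) * regCount d H := by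
    intro T hT
    rw [mem_filter, mem_powersetCard, not_disjoint_iff] at hT
    obtain ⟨⟨-, h3⟩, ⟨a, haT, haW⟩, hnew⟩ := hT
    have h2 : (T.erase a).card = 2 := by rw [card_erase_of_mem haT, h3]
    obtain ⟨b, c, hbc, he⟩ := card_eq_two.1 h2
    have hTe : T = {a, b, c} := by rw [← insert_erase haT, he]
    have hb : b ∈ T.erase a := by rw [he]; simp
    have hc : c ∈ T.erase a := by rw [he]; simp
    refine ⟨(a, b, c), haW, hTe, ?_⟩
    rw [hTe] at hnew ⊢
    exact regCount_sup_triangle_le hd hn hm hHW (ne_of_mem_erase hb).symm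
      (ne_of_mem_erase hc).symm hbc hnew
  have : Nonempty V := Fintype.card_pos_iff.1 (by omega)
  choose! t ht1 ht2 ht3 using hsel
  have hinj : Set.InjOn t (((powersetCard 3 univ).filter fun T : Finset V =>
      ¬ Disjoint T W ∧ ¬ completeOn T ≤ H : Finset (Finset V)) : Set (Finset V)) := by
    intro T hT T' hT' e
    rw [ht2 T hT, ht2 T' hT', e]
  have hD : (3 : ℝ) ≤ d := by exact_mod_cast hd
  have hN : (16 * d : ℝ) ≤ Fintype.card V := by exact_mod_cast hn
  have hN0 : (0 : ℝ) < Fintype.card V := by linarith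
  have hW' : (W.card : ℝ) ≤ 9 := by exact_mod_cast hW
  have hgsum : ∑ x, g x ≤ 5 * d := by
    calc ∑ x, g x ≤ ∑ x, ((if x ∈ W then 1 else 0) + p) := by
          refine sum_le_sum fun x _ => ?_
          simp only [hg]
          split_ifs <;> linarith
      _ = W.card + Fintype.card V * p := by
          rw [sum_add_distrib, sum_boole, sum_const, card_univ, nsmul_eq_mul]
          simp
      _ ≤ 5 * d := by
          have : Fintype.card V * p = 2 * d := by rw [hpdef]; field_simp
          linarith
  calc _ ≤ ∑ T ∈ (powersetCard 3 univ).filter fun T : Finset V =>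
        ¬ Disjoint T W ∧ ¬ completeOn T ≤ H,
          p * (g (t T).2.1 * g (t T).2.2) * regCount d H := sum_le_sum ht3
    _ = ∑ s ∈ ((powersetCard 3 univ).filter fun T : Finset V =>
        ¬ Disjoint T W ∧ ¬ completeOn T ≤ H).image t, p * (g s.2.1 * g s.2.2) * regCount d H :=
        by rw [sum_image hinj]
    _ ≤ ∑ s ∈ W ×ˢ (univ : Finset (V × V)), p * (g s.2.1 * g s.2.2) * regCount d H := by
        refine sum_le_sum_of_subset_of_nonneg ?_ fun s _ _ => ?_
        · intro s hs
          obtain ⟨T, hT, rfl⟩ := mem_image.1 hs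
          exact mem_product.2 ⟨ht1 T hT, mem_univ _⟩
        · have := hg0 s.2.1
          have := hg0 s.2.2
          positivity
    _ = W.card * (p * ((∑ x, g x) * ∑ x, g x)) * regCount d H := by
        rw [← sum_mul, ← mul_sum, sum_product]
        dsimp only
        rw [sum_const, sum_mul_sum, ← univ_product_univ, sum_product, nsmul_eq_mul]
        ring
    _ ≤ 9 * (p * ((5 * d) * (5 * d))) * regCount d H := by
        have : 0 ≤ ∑ x, g x := sum_nonneg fun x _ => hg0 x
        gcongr
    _ = _ := by rw [hpdef]; ring

/-- The vertex sets of the triangles of `G`. -/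
noncomputable def triSets (G : SimpleGraph V) : Finset (Finset V) :=
  (powersetCard 3 univ).filter fun T => completeOn T ≤ G

lemma mem_triSets {G : SimpleGraph V} {T : Finset V} :
    T ∈ triSets G ↔ T ∈ powersetCard 3 univ ∧ completeOn T ≤ G := by
  rw [triSets, mem_filter]

/-- The number of pairs of a `d`-regular graph and a set of `j` triangles in it. -/
noncomputable def triFamilyCount (V : Type*) [Fintype V] (d j : ℕ) : ℝ :=
  ∑ L ∈ powersetCard j (powersetCard 3 (univ : Finset V)), regCount d (L.sup completeOn)

lemma sum_families_regAbove (d j : ℕ) (f : SimpleGraph V → ℝ) :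
    ∑ L ∈ powersetCard j (powersetCard 3 (univ : Finset V)),
      ∑ G ∈ regAbove d (L.sup completeOn), f G =
    ∑ G ∈ regAbove d (⊥ : SimpleGraph V), ((triSets G).card.choose j : ℝ) * f G := by
  have : ∀ G : SimpleGraph V, ((triSets G).card.choose j : ℝ) * f G =
      ∑ _L ∈ powersetCard j (triSets G), f G := by
    intro G
    rw [sum_const, card_powersetCard, nsmul_eq_mul]
  rw [sum_congr rfl fun G _ => this G]
  refine sum_comm' fun L G => ?_
  simp only [mem_regAbove, mem_powersetCard, bot_le, true_and, Finset.sup_le_iff]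
  constructor
  · rintro ⟨⟨h1, h2⟩, h3, h4⟩
    exact ⟨⟨fun T hT => mem_triSets.2 ⟨h1 hT, h3 T hT⟩, h2⟩, h4⟩
  · rintro ⟨⟨h1, h2⟩, h4⟩
    exact ⟨⟨fun T hT => (mem_triSets.1 (h1 hT)).1, h2⟩,
      fun T hT => (mem_triSets.1 (h1 hT)).2, h4⟩

lemma triFamilyCount_eq (d j : ℕ) :
    triFamilyCount V d j =
      ∑ G ∈ regAbove d (⊥ : SimpleGraph V), ((triSets G).card.choose j : ℝ) := by
  have := sum_families_regAbove (V := V) d j fun _ => 1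
  simp only [mul_one, sum_const, nsmul_eq_mul] at this
  exact this

lemma triFamilyCount_nonneg (d j : ℕ) : 0 ≤ triFamilyCount V d j :=
  sum_nonneg fun _ _ => regCount_nonneg _ _

lemma sum_regCount_sup_completeOn (d : ℕ) (K : SimpleGraph V) (s : Finset (Finset V)) :
    ∑ T ∈ s, regCount d (K ⊔ completeOn T) =
      ∑ G ∈ regAbove d K, ((s.filter fun T => completeOn T ≤ G).card : ℝ) := by
  have h1 : ∀ T, regCount d (K ⊔ completeOn T) =
      ∑ _G ∈ (regAbove d K).filter fun G => completeOn T ≤ G, (1 : ℝ) := by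
    intro T
    rw [regCount, sum_const, nsmul_eq_mul, mul_one]
    congr 2
    ext G
    simp only [mem_filter, mem_regAbove, sup_le_iff]
    tauto
  rw [sum_congr rfl fun T _ => h1 T,
    sum_comm' (t' := regAbove d K) (s' := fun G => s.filter fun T => completeOn T ≤ G)]
  · refine sum_congr rfl fun G _ => ?_
    rw [sum_const, nsmul_eq_mul, mul_one]
  · intro T G
    simp only [mem_filter]
    tauto

lemma succ_mul_triFamilyCount_succ (d j : ℕ) :
    (j + 1 : ℝ) * triFamilyCount V d (j + 1) =
      ∑ L ∈ powersetCard j (powersetCard 3 (univ : Finset V)),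
        ∑ T ∈ powersetCard 3 univ \ L, regCount d (L.sup completeOn ⊔ completeOn T) := by
  have h : ∀ L ∈ powersetCard j (powersetCard 3 (univ : Finset V)),
      ∑ T ∈ powersetCard 3 univ \ L, regCount d (L.sup completeOn ⊔ completeOn T) =
        ∑ G ∈ regAbove d (L.sup completeOn), (((triSets G).card : ℝ) - j) := by
    intro L hL
    rw [mem_powersetCard] at hL
    rw [sum_regCount_sup_completeOn]
    refine sum_congr rfl fun G hG => ?_
    have hLG : L ⊆ triSets G := fun T hT =>
      mem_triSets.2 ⟨hL.1 hT, Finset.sup_le_iff.1 (mem_regAbove.1 hG).1 T hT⟩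
    have : ((powersetCard 3 univ \ L).filter fun T => completeOn T ≤ G) = triSets G \ L := by
      ext T
      simp only [mem_filter, Finset.mem_sdiff, mem_triSets]
      tauto
    rw [this, card_sdiff_of_subset hLG, Nat.cast_sub (card_le_card hLG), hL.2]
  rw [sum_congr rfl h, sum_families_regAbove, triFamilyCount_eq, mul_sum]
  refine sum_congr rfl fun G _ => ?_
  have hc := Nat.choose_succ_right_eq (triSets G).card j
  rcases le_or_gt j (triSets G).card with hj | hj
  · rw [← Nat.cast_sub hj]
    rw [mul_comm]
    exact_mod_cast hc
  · rw [Nat.choose_eq_zero_of_lt hj, Nat.choose_eq_zero_of_lt (hj.trans (Nat.lt_succ_self j))]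
    simp

lemma arcCard_completeOn_le {T : Finset V} (hT : T.card = 3) : arcCard (completeOn T) ≤ 6 := by
  obtain ⟨a, b, c, -, -, -, rfl⟩ := card_eq_three.1 hT
  rw [completeOn_triple]
  have h1 := arcCard_sup_edge_le (SimpleGraph.edge a b ⊔ SimpleGraph.edge b c) a c
  have h2 := arcCard_sup_edge_le (SimpleGraph.edge a b) b c
  have h3 := arcCard_edge_le a b
  omega

lemma arcCard_sup_completeOn_le {L : Finset (Finset V)} (hL : L ⊆ powersetCard 3 univ) :
    arcCard (L.sup completeOn) ≤ 6 * L.card := by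
  induction L using Finset.induction_on with
  | empty => simp [arcCard]
  | insert T L hT ih =>
    rw [insert_subset_iff] at hL
    rw [sup_insert, card_insert_of_notMem hT]
    have h1 := ih hL.2
    have h2 := arcCard_completeOn_le (mem_powersetCard.1 hL.1).2
    have h3 := arcCard_sup_le (completeOn T) (L.sup completeOn)
    omega

lemma card_biUnion_triples_le {L : Finset (Finset V)} (hL : L ⊆ powersetCard 3 univ) :
    (L.biUnion id).card ≤ L.card * 3 :=
  card_biUnion_le_card_mul _ _ _ fun _ hT => (mem_powersetCard.1 (hL hT)).2.le

/-- A triangle covered by a family of triangles that does not contain it yields two distinct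
members of the family sharing a vertex, out of at least three members. -/
lemma exists_pair_of_completeOn_le {L : Finset (Finset V)} (hL : L ⊆ powersetCard 3 univ)
    {T : Finset V} (hT : T.card = 3) (hTL : T ∉ L) (hle : completeOn T ≤ L.sup completeOn) :
    3 ≤ L.card ∧ ∃ A ∈ L, ∃ B ∈ L, A ≠ B ∧ ∃ x, x ∈ A ∧ x ∈ B := by
  obtain ⟨a, b, c, hab, hac, hbc, rfl⟩ := card_eq_three.1 hT
  obtain ⟨A, hA, hA1, hA2, -⟩ := sup_completeOn_adj.1
    (hle (show (completeOn {a, b, c}).Adj a b from ⟨by simp, by simp, hab⟩))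
  obtain ⟨B, hB, hB1, hB2, -⟩ := sup_completeOn_adj.1
    (hle (show (completeOn {a, b, c}).Adj b c from ⟨by simp, by simp, hbc⟩))
  obtain ⟨C, hC, hC1, hC2, -⟩ := sup_completeOn_adj.1
    (hle (show (completeOn {a, b, c}).Adj a c from ⟨by simp, by simp, hac⟩))
  have key : ∀ X ∈ L, a ∈ X → b ∈ X → c ∈ X → False := by
    intro X hX ha hb hc
    have hs : ({a, b, c} : Finset V) ⊆ X := by
      intro x hx
      simp only [mem_insert, mem_singleton] at hx
      rcases hx with rfl | rfl | rfl <;> assumption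
    have := eq_of_subset_of_card_le hs (by rw [hT, (mem_powersetCard.1 (hL hX)).2])
    exact hTL (this ▸ hX)
  have hAB : A ≠ B := fun e => key A hA hA1 hA2 (e ▸ hB2)
  have hAC : A ≠ C := fun e => key A hA hA1 hA2 (e ▸ hC2)
  have hBC : B ≠ C := fun e => key B hB (e ▸ hC1) hB1 hB2
  refine ⟨?_, A, hA, B, hB, hAB, b, hA2, hB1⟩
  rw [← card_eq_three.2 ⟨A, B, C, hAB, hAC, hBC, rfl⟩]
  refine card_le_card fun X hX => ?_
  simp only [mem_insert, mem_singleton] at hX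
  rcases hX with rfl | rfl | rfl <;> assumption

/-- The total count over new triangles meeting the triangles in `L`. -/
lemma sum_sdiff_le_of_family {d : ℕ} (hd : 3 ≤ d) (hn : 30 * d ≤ Fintype.card V)
    (hn' : 200 ≤ Fintype.card V) {L : Finset (Finset V)} (hL : L ⊆ powersetCard 3 univ)
    (hL3 : L.card ≤ 3) :
    |∑ T ∈ powersetCard 3 univ \ L, regCount d (L.sup completeOn ⊔ completeOn T) -
        ((d - 1) ^ 3 / 6) * regCount d (L.sup completeOn) -
        (((powersetCard 3 univ \ L).filter fun T => completeOn T ≤ L.sup completeOn).card : ℝ) *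
          regCount d (L.sup completeOn)| ≤
      671 * d ^ 3 / Fintype.card V * (((d - 1) ^ 3 / 6) * regCount d (L.sup completeOn)) := by
  set K := L.sup completeOn with hK
  set W := L.biUnion id with hWdef
  have hW : W.card ≤ 9 := (card_biUnion_triples_le hL).trans (by omega)
  have hm : arcCard K ≤ 30 := (arcCard_sup_completeOn_le hL).trans (by omega)
  have hHW : ∀ a b, K.Adj a b → a ∈ W := fun a b h => mem_biUnion_of_adj h
  have h1 := abs_sum_regCount_avoiding_sub_le hd hn hn' hm hW hHW
  have h2 := sum_regCount_meeting_le hd (by omega) hm hW hHW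
  have hmem : ∀ T ∈ L, T ⊆ W := fun T hT x hx => mem_biUnion.2 ⟨T, hT, hx⟩
  have hKmem : ∀ T ∈ L, completeOn T ≤ K := fun T hT => le_sup (f := completeOn) hT
  have hne : ∀ T ∈ powersetCard 3 (univ : Finset V), Disjoint T W → ¬ T ⊆ W := by
    intro T hT hd' hs
    have := disjoint_self.1 (disjoint_of_subset_right hs hd')
    rw [mem_powersetCard, this] at hT
    simp at hT
  have hle : ∀ T ∈ powersetCard 3 (univ : Finset V), completeOn T ≤ K → T ⊆ W := by
    intro T hT hc x hx
    have h3 := (mem_powersetCard.1 hT).2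
    obtain ⟨y, hy, hyx⟩ := exists_mem_ne (by omega : 1 < T.card) x
    exact hHW x y (hc ⟨hx, hy, hyx.symm⟩)
  have hsplit : ∑ T ∈ powersetCard 3 univ \ L, regCount d (K ⊔ completeOn T) =
      ∑ T ∈ powersetCard 3 (univ \ W), regCount d (K ⊔ completeOn T) +
      ∑ T ∈ (powersetCard 3 univ).filter fun T => ¬ Disjoint T W ∧ ¬ completeOn T ≤ K,
        regCount d (K ⊔ completeOn T) +
      (((powersetCard 3 univ \ L).filter fun T => completeOn T ≤ K).card : ℝ) *
        regCount d K := by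
    have hc : (((powersetCard 3 univ \ L).filter fun T => completeOn T ≤ K).card : ℝ) *
        regCount d K = ∑ T ∈ (powersetCard 3 univ \ L).filter fun T => completeOn T ≤ K,
          regCount d (K ⊔ completeOn T) := by
      rw [← nsmul_eq_mul, ← sum_const]
      refine sum_congr rfl fun T hT => ?_
      rw [sup_eq_left.2 (mem_filter.1 hT).2]
    rw [hc, ← sum_filter_add_sum_filter_not (powersetCard 3 univ \ L)
      (fun T => completeOn T ≤ K) _, add_comm]
    congr 1
    rw [← sum_filter_add_sum_filter_not ((powersetCard 3 univ \ L).filter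
      fun T => ¬ completeOn T ≤ K) (fun T => Disjoint T W) _]
    congr 1
    · refine sum_congr ?_ fun _ _ => rfl
      ext T
      simp only [mem_filter, Finset.mem_sdiff, mem_powersetCard]
      constructor
      · rintro ⟨⟨⟨⟨-, h3⟩, -⟩, -⟩, hd'⟩
        exact ⟨fun x hx => Finset.mem_sdiff.2 ⟨mem_univ x, disjoint_left.1 hd' hx⟩, h3⟩
      · rintro ⟨hs, h3⟩
        have hd' : Disjoint T W :=
          disjoint_left.2 fun x hx => (Finset.mem_sdiff.1 (hs hx)).2
        have hT : T ∈ powersetCard 3 (univ : Finset V) :=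
          mem_powersetCard.2 ⟨subset_univ _, h3⟩
        have := hne T hT hd'
        exact ⟨⟨⟨⟨subset_univ _, h3⟩, fun h => this (hmem T h)⟩,
          fun h => this (hle T hT h)⟩, hd'⟩
    · refine sum_congr ?_ fun _ _ => rfl
      ext T
      simp only [mem_filter, Finset.mem_sdiff]
      constructor
      · rintro ⟨⟨⟨hT, -⟩, hc⟩, hd'⟩
        exact ⟨hT, hd', hc⟩
      · rintro ⟨hT, hd', hc⟩
        exact ⟨⟨⟨hT, fun h => hc (hKmem T h)⟩, hc⟩, hd'⟩
  have h3 : 0 ≤ ∑ T ∈ (powersetCard 3 univ).filter fun T => ¬ Disjoint T W ∧ ¬ completeOn T ≤ K,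
      regCount d (K ⊔ completeOn T) := sum_nonneg fun _ _ => regCount_nonneg _ _
  have hD : (3 : ℝ) ≤ d := by exact_mod_cast hd
  have hN : (200 : ℝ) ≤ Fintype.card V := by exact_mod_cast hn'
  have hR := regCount_nonneg d K
  have hlam : (1 : ℝ) ≤ (d - 1) ^ 3 / 6 := by
    have : (2 : ℝ) ^ 3 ≤ (d - 1) ^ 3 := pow_le_pow_left₀ (by norm_num) (by linarith) 3
    linarith
  have h4 : 450 * (d : ℝ) ^ 3 / Fintype.card V * regCount d K ≤
      450 * d ^ 3 / Fintype.card V * (((d - 1) ^ 3 / 6) * regCount d K) :=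
    mul_le_mul_of_nonneg_left (le_mul_of_one_le_left hR hlam) (by positivity)
  have h5 : 221 * (d : ℝ) / Fintype.card V * (((d - 1) ^ 3 / 6) * regCount d K) ≤
      221 * d ^ 3 / Fintype.card V * (((d - 1) ^ 3 / 6) * regCount d K) := by
    have : (d : ℝ) ≤ d ^ 3 := le_self_pow₀ (by linarith) (by norm_num)
    gcongr
  have h6 : 671 * (d : ℝ) ^ 3 / Fintype.card V * (((d - 1) ^ 3 / 6) * regCount d K) =
      450 * d ^ 3 / Fintype.card V * (((d - 1) ^ 3 / 6) * regCount d K) +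
      221 * d ^ 3 / Fintype.card V * (((d - 1) ^ 3 / 6) * regCount d K) := by ring
  rw [hsplit, h6]
  rw [abs_le] at h1 ⊢
  constructor <;> linarith

/-- The triangles in `L` cover the edges of a further triangle. -/
def CoversNew (L : Finset (Finset V)) : Prop :=
  ∃ T ∈ powersetCard 3 univ \ L, completeOn T ≤ L.sup completeOn

/-- Families of three triangles covering a further triangle are rare. -/
lemma sum_covering_le {d : ℕ} (hd : 3 ≤ d) (hn : 30 * d ≤ Fintype.card V) :
    ∑ L ∈ (powersetCard 3 (powersetCard 3 (univ : Finset V))).filter fun L =>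
        CoversNew L,
      regCount d (L.sup completeOn) ≤
    450 * d ^ 3 / Fintype.card V * triFamilyCount V d 2 := by
  set P := (powersetCard 3 (powersetCard 3 (univ : Finset V))).filter fun L =>
        CoversNew L with hP
  have hsel : ∀ L ∈ P, ∃ B ∈ L, ¬ Disjoint B ((L.erase B).biUnion id) := by
    intro L hL
    rw [hP, mem_filter, mem_powersetCard] at hL
    obtain ⟨⟨hL, -⟩, T, hT, hle⟩ := hL
    rw [Finset.mem_sdiff, mem_powersetCard] at hT
    obtain ⟨-, A, hA, B, hB, hAB, x, hxA, hxB⟩ :=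
      exists_pair_of_completeOn_le hL hT.1.2 hT.2 hle
    exact ⟨B, hB, not_disjoint_iff.2 ⟨x, hxB, mem_biUnion.2 ⟨A, mem_erase.2 ⟨hAB, hA⟩, hxA⟩⟩⟩
  choose! B hB1 hB2 using hsel
  have hins : ∀ L ∈ P, insert (B L) (L.erase (B L)) = L := fun L hL => insert_erase (hB1 L hL)
  set Q := (powersetCard 2 (powersetCard 3 (univ : Finset V))).sigma fun L =>
    (powersetCard 3 univ).filter fun T : Finset V =>
      ¬ Disjoint T (L.biUnion id) ∧ ¬ completeOn T ≤ L.sup completeOn with hQ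
  set φ : Finset (Finset V) → (_ : Finset (Finset V)) × Finset V :=
    fun L => ⟨L.erase (B L), B L⟩ with hφ
  have hmaps : ∀ L ∈ P, φ L ∈ Q := by
    intro L hL
    have hL' := hL
    rw [hP, mem_filter, mem_powersetCard] at hL'
    obtain ⟨⟨hLs, hLc⟩, -⟩ := hL'
    have hBs := hLs (hB1 L hL)
    have hes := (erase_subset (B L) L).trans hLs
    have hec : (L.erase (B L)).card = 2 := by rw [card_erase_of_mem (hB1 L hL), hLc]
    refine mem_sigma.2 ⟨mem_powersetCard.2 ⟨hes, hec⟩, mem_filter.2 ⟨hBs, hB2 L hL, fun h => ?_⟩⟩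
    have := (exists_pair_of_completeOn_le hes (mem_powersetCard.1 hBs).2
      (notMem_erase _ _) h).1
    omega
  have hinj : Set.InjOn φ (P : Set (Finset (Finset V))) := by
    intro L hL L' hL' e
    simp only [hφ, Sigma.mk.injEq, heq_eq_eq] at e
    rw [← hins L hL, ← hins L' hL', e.1, e.2]
  calc _ = ∑ L ∈ P, regCount d ((φ L).1.sup completeOn ⊔ completeOn (φ L).2) := by
        refine sum_congr rfl fun L hL => ?_
        conv_lhs => rw [← hins L hL, sup_insert, sup_comm]
    _ = ∑ q ∈ P.image φ, regCount d (q.1.sup completeOn ⊔ completeOn q.2) := by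
        rw [sum_image hinj]
    _ ≤ ∑ q ∈ Q, regCount d (q.1.sup completeOn ⊔ completeOn q.2) := by
        refine sum_le_sum_of_subset_of_nonneg (fun q hq => ?_) fun _ _ _ => regCount_nonneg _ _
        obtain ⟨L, hL, rfl⟩ := mem_image.1 hq
        exact hmaps L hL
    _ ≤ ∑ L ∈ powersetCard 2 (powersetCard 3 (univ : Finset V)),
        450 * d ^ 3 / Fintype.card V * regCount d (L.sup completeOn) := by
        rw [hQ, sum_sigma]
        refine sum_le_sum fun L hL => ?_
        rw [mem_powersetCard] at hL
        refine sum_regCount_meeting_le hd (by omega) ?_ ?_ fun a b h => mem_biUnion_of_adj h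
        · exact (arcCard_sup_completeOn_le hL.1).trans (by omega)
        · exact (card_biUnion_triples_le hL.1).trans (by omega)
    _ = _ := by rw [← mul_sum]; rfl

lemma card_covered_le {L : Finset (Finset V)} (hL : L ⊆ powersetCard 3 univ)
    (hL3 : L.card ≤ 3) :
    ((powersetCard 3 univ \ L).filter fun T => completeOn T ≤ L.sup completeOn).card ≤ 84 := by
  have hW : (L.biUnion id).card ≤ 9 := (card_biUnion_triples_le hL).trans (by omega)
  calc _ ≤ (powersetCard 3 (L.biUnion id)).card := by
        refine card_le_card fun T hT => ?_
        simp only [mem_filter, Finset.mem_sdiff, mem_powersetCard] at hT ⊢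
        refine ⟨fun x hx => ?_, hT.1.1.2⟩
        obtain ⟨y, hy, hyx⟩ := exists_mem_ne (by omega : 1 < T.card) x
        exact mem_biUnion_of_adj (hT.2 ⟨hx, hy, hyx.symm⟩)
    _ = (L.biUnion id).card.choose 3 := card_powersetCard _ _
    _ ≤ (9).choose 3 := Nat.choose_le_choose 3 hW
    _ = 84 := rfl

/-- Approximate recursion with an explicit contribution of covered triangles. -/
lemma abs_triFamilyCount_succ_sub_le_add {d : ℕ} (hd : 3 ≤ d) (hn : 30 * d ≤ Fintype.card V)
    (hn' : 200 ≤ Fintype.card V) {j : ℕ} (hj : j ≤ 3) {R : ℝ}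
    (hR : ∑ L ∈ powersetCard j (powersetCard 3 (univ : Finset V)),
      (((powersetCard 3 univ \ L).filter fun T => completeOn T ≤ L.sup completeOn).card : ℝ) *
          regCount d (L.sup completeOn) ≤ R) :
    |(j + 1) * triFamilyCount V d (j + 1) - ((d - 1) ^ 3 / 6) * triFamilyCount V d j| ≤
      671 * d ^ 3 / Fintype.card V * (((d - 1) ^ 3 / 6) * triFamilyCount V d j) + R := by
  have h0 : 0 ≤ ∑ L ∈ powersetCard j (powersetCard 3 (univ : Finset V)),
      (((powersetCard 3 univ \ L).filter fun T => completeOn T ≤ L.sup completeOn).card : ℝ) *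
          regCount d (L.sup completeOn) :=
    sum_nonneg fun _ _ => mul_nonneg (Nat.cast_nonneg _) (regCount_nonneg _ _)
  have key := (abs_sum_le_sum_abs _ _).trans (sum_le_sum fun L hL =>
    sum_sdiff_le_of_family (V := V) hd hn hn' (mem_powersetCard.1 hL).1
      ((mem_powersetCard.1 hL).2.le.trans hj))
  rw [sum_sub_distrib, sum_sub_distrib, ← succ_mul_triFamilyCount_succ, ← mul_sum, ← mul_sum,
    ← mul_sum] at key
  change |_ - _ * triFamilyCount V d j - _| ≤ _ * (_ * triFamilyCount V d j) at key
  rw [abs_le] at key ⊢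
  constructor <;> linarith

lemma abs_triFamilyCount_succ_sub_le_of_le_two {d : ℕ} (hd : 3 ≤ d)
    (hn : 30 * d ≤ Fintype.card V) (hn' : 200 ≤ Fintype.card V) {j : ℕ} (hj : j ≤ 2) :
    |(j + 1) * triFamilyCount V d (j + 1) - ((d - 1) ^ 3 / 6) * triFamilyCount V d j| ≤
      671 * d ^ 3 / Fintype.card V * (((d - 1) ^ 3 / 6) * triFamilyCount V d j) := by
  have := abs_triFamilyCount_succ_sub_le_add (V := V) hd hn hn' (hj.trans (by norm_num))
    (R := 0) (sum_nonpos fun L hL => ?_)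
  · rwa [add_zero] at this
  · rw [mem_powersetCard] at hL
    have he : (powersetCard 3 univ \ L).filter (fun T => completeOn T ≤ L.sup completeOn) = ∅ := by
      refine filter_eq_empty_iff.2 fun T hT h => ?_
      rw [Finset.mem_sdiff, mem_powersetCard] at hT
      have := (exists_pair_of_completeOn_le hL.1 hT.1.2 hT.2 h).1
      omega
    rw [he]
    simp

lemma abs_triFamilyCount_four_sub_le {d : ℕ} (hd : 3 ≤ d)
    (hn : 30 * d ≤ Fintype.card V) (hn' : 200 ≤ Fintype.card V) :
    |(3 + 1) * triFamilyCount V d 4 - ((d - 1) ^ 3 / 6) * triFamilyCount V d 3| ≤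
      671 * d ^ 3 / Fintype.card V * (((d - 1) ^ 3 / 6) * triFamilyCount V d 3) +
        37800 * d ^ 3 / Fintype.card V * triFamilyCount V d 2 := by
  refine abs_triFamilyCount_succ_sub_le_add (V := V) hd hn hn' (j := 3) le_rfl ?_
  calc _ ≤ ∑ L ∈ powersetCard 3 (powersetCard 3 (univ : Finset V)),
        if CoversNew L then
          84 * regCount d (L.sup completeOn) else 0 := by
        refine sum_le_sum fun L hL => ?_
        rw [mem_powersetCard] at hL
        split_ifs with h
        · have := card_covered_le hL.1 hL.2.le
          exact mul_le_mul_of_nonneg_right (by exact_mod_cast this) (regCount_nonneg _ _)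
        · rw [CoversNew] at h
          push Not at h
          rw [filter_eq_empty_iff.2 fun T hT => h T hT]
          simp
    _ = 84 * ∑ L ∈ (powersetCard 3 (powersetCard 3 (univ : Finset V))).filter fun L =>
        CoversNew L,
          regCount d (L.sup completeOn) := by
        rw [← sum_filter, mul_sum]
    _ ≤ 84 * (450 * d ^ 3 / Fintype.card V * triFamilyCount V d 2) :=
        mul_le_mul_of_nonneg_left (sum_covering_le hd hn) (by norm_num)
    _ = _ := by ring

/-- Approximate recursion for the number of families of triangles in regular graphs. -/
lemma abs_triFamilyCount_succ_sub_le {d : ℕ} (hd : 3 ≤ d)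
    (hn : 4 * 10 ^ 6 * d ^ 3 ≤ Fintype.card V) {j : ℕ} (hj : j ≤ 3) :
    |(j + 1) * triFamilyCount V d (j + 1) - ((d - 1) ^ 3 / 6) * triFamilyCount V d j| ≤
      10 ^ 6 * d ^ 3 / Fintype.card V * (((d - 1) ^ 3 / 6) * triFamilyCount V d j) := by
  have hd3 : d ≤ d ^ 3 := Nat.le_self_pow (by norm_num) d
  have hn1 : 30 * d ≤ Fintype.card V := by omega
  have hn2 : 200 ≤ Fintype.card V := by omega
  have hD : (3 : ℝ) ≤ d := by exact_mod_cast hd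
  have hN : (200 : ℝ) ≤ Fintype.card V := by exact_mod_cast hn2
  have hlam : (1 : ℝ) ≤ (d - 1) ^ 3 / 6 := by
    have : (2 : ℝ) ^ 3 ≤ (d - 1) ^ 3 := pow_le_pow_left₀ (by norm_num) (by linarith) 3
    linarith
  set lam : ℝ := (d - 1) ^ 3 / 6 with hlamdef
  set c : ℝ := d ^ 3 / Fintype.card V with hc
  have hc0 : 0 ≤ c := by positivity
  have hc1 : 4 * 10 ^ 6 * c ≤ 1 := by
    rw [hc, ← mul_div_assoc, div_le_one (by linarith)]
    exact_mod_cast hn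
  have e1 (t : ℝ) : t * d ^ 3 / Fintype.card V = t * c := by rw [hc, mul_div_assoc]
  rcases Nat.lt_or_ge j 3 with hj2 | hj3
  · refine (abs_triFamilyCount_succ_sub_le_of_le_two hd hn1 hn2 (by omega)).trans ?_
    rw [e1, e1]
    have := triFamilyCount_nonneg (V := V) d j
    gcongr
    norm_num
  · obtain rfl : j = 3 := by omega
    have h4 := abs_triFamilyCount_four_sub_le (V := V) hd hn1 hn2
    have h3 := abs_triFamilyCount_succ_sub_le_of_le_two (V := V) hd hn1 hn2 (j := 2) le_rfl
    rw [← hlamdef, e1] at h3 h4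
    rw [e1] at h4 ⊢
    have p2 := triFamilyCount_nonneg (V := V) d 2
    have p3 := triFamilyCount_nonneg (V := V) d 3
    norm_num at h3 h4 ⊢
    set S2 := triFamilyCount V d 2
    set S3 := triFamilyCount V d 3
    have q2 : S2 ≤ lam * S2 := le_mul_of_one_le_left p2 hlam
    have q3 : S3 ≤ lam * S3 := le_mul_of_one_le_left p3 hlam
    have h5 : 671 * c * (lam * S2) ≤ 1 / 2 * (lam * S2) := by
      gcongr
      linarith
    have h6 := (abs_le.1 h3).1
    have h7 : S2 ≤ 6 * (lam * S3) := by linarith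
    have h8 := mul_le_mul_of_nonneg_left h7 (by positivity : 0 ≤ 37800 * c)
    have h9 : 0 ≤ c * (lam * S3) := by positivity
    refine h4.trans ?_
    linarith

/-- A mean-like sequence of factorial moments yields bounds for the ordinary moments. -/
lemma moment_bounds {lam ε K s₁ s₂ s₃ s₄ : ℝ} (hlam : 1 ≤ lam) (hε : 0 ≤ ε) (hε' : ε ≤ 1 / 4)
    (hK : ε * lam ^ 2 ≤ K) (h1 : |s₁ - lam| ≤ ε * lam)
    (h2 : |s₂ - lam * s₁| ≤ ε * (lam * s₁)) (h3 : |s₃ - lam * s₂| ≤ ε * (lam * s₂))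
    (h4 : |s₄ - lam * s₃| ≤ ε * (lam * s₃)) (p2 : 0 ≤ s₂) (p3 : 0 ≤ s₃) :
    |s₂ - s₁ ^ 2| ≤ 16 * K ∧ |s₃ - s₁ ^ 3| ≤ 48 * K * s₁ ∧ |s₄ - s₁ ^ 4| ≤ 112 * K * s₁ ^ 2 ∧
      1 ≤ 2 * s₁ := by
  have hεl : ε * lam ≤ 1 / 4 * lam := mul_le_mul_of_nonneg_right hε' (by linarith)
  have h1' := abs_le.1 h1
  have hs1 : lam ≤ 2 * s₁ := by linarith
  have hs2 : s₁ ≤ 2 * lam := by linarith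
  have p1 : 0 ≤ s₁ := by linarith
  have hl : ε * lam ≤ ε * (2 * s₁) := mul_le_mul_of_nonneg_left hs1 hε
  have step {s t : ℝ} (hs : 0 ≤ s) (h : |t - lam * s| ≤ ε * (lam * s)) :
      |t - s₁ * s| ≤ 4 * ε * s₁ * s := by
    have a1 : |lam * s - s₁ * s| ≤ ε * lam * s := by
      rw [← sub_mul, abs_mul, abs_of_nonneg hs, abs_sub_comm]
      exact mul_le_mul_of_nonneg_right h1 hs
    have a2 := mul_le_mul_of_nonneg_right hl hs
    have a3 := abs_sub_le t (lam * s) (s₁ * s)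
    linarith
  have k2 := step p1 h2
  have k3 := step p2 h3
  have k4 := step p3 h4
  have hx2 : 4 * ε * s₁ ^ 2 ≤ 16 * K := by
    have : s₁ ^ 2 ≤ (2 * lam) ^ 2 := pow_le_pow_left₀ p1 hs2 2
    have := mul_le_mul_of_nonneg_left this hε
    linarith
  have b2 : |s₂ - s₁ ^ 2| ≤ 4 * ε * s₁ ^ 2 := by
    rw [pow_two, ← mul_assoc]
    exact k2
  have hη : 4 * ε ≤ 1 := by linarith
  have u2 : s₂ ≤ 2 * s₁ ^ 2 := by
    have := mul_le_mul_of_nonneg_right hη (sq_nonneg s₁)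
    linarith [(abs_le.1 b2).2]
  have hη1 : 0 ≤ 4 * ε * s₁ := by positivity
  have b3 : |s₃ - s₁ ^ 3| ≤ 3 * (4 * ε * s₁ ^ 2) * s₁ := by
    have a1 : |s₁ * s₂ - s₁ ^ 3| ≤ s₁ * (4 * ε * s₁ ^ 2) := by
      rw [show s₁ * s₂ - s₁ ^ 3 = s₁ * (s₂ - s₁ ^ 2) by ring, abs_mul, abs_of_nonneg p1]
      exact mul_le_mul_of_nonneg_left b2 p1
    have a2 := mul_le_mul_of_nonneg_left u2 hη1
    have a3 := abs_sub_le s₃ (s₁ * s₂) (s₁ ^ 3)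
    linarith
  have u3 : s₃ ≤ 4 * s₁ ^ 3 := by
    have := mul_le_mul_of_nonneg_right hη (pow_nonneg p1 3)
    linarith [(abs_le.1 b3).2]
  have b4 : |s₄ - s₁ ^ 4| ≤ 7 * (4 * ε * s₁ ^ 2) * s₁ ^ 2 := by
    have a1 : |s₁ * s₃ - s₁ ^ 4| ≤ s₁ * (3 * (4 * ε * s₁ ^ 2) * s₁) := by
      rw [show s₁ * s₃ - s₁ ^ 4 = s₁ * (s₃ - s₁ ^ 3) by ring, abs_mul, abs_of_nonneg p1]
      exact mul_le_mul_of_nonneg_left b3 p1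
    have a2 := mul_le_mul_of_nonneg_left u3 hη1
    have a3 := abs_sub_le s₄ (s₁ * s₃) (s₁ ^ 4)
    linarith
  refine ⟨b2.trans hx2, ?_, ?_, by linarith⟩
  · have := mul_le_mul_of_nonneg_right hx2 p1
    linarith
  · have := mul_le_mul_of_nonneg_right hx2 (sq_nonneg s₁)
    linarith

/-- The mean of `f` over the `d`-regular graphs on `V`. -/
noncomputable def regMean (d : ℕ) (f : SimpleGraph V → ℝ) : ℝ :=
  (∑ G ∈ regAbove d (⊥ : SimpleGraph V), f G) / regCount d (⊥ : SimpleGraph V)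

lemma regMean_add (d : ℕ) (f g : SimpleGraph V → ℝ) :
    regMean d (fun G => f G + g G) = regMean d f + regMean d g := by
  simp only [regMean, sum_add_distrib, add_div]

lemma regMean_const_mul (d : ℕ) (c : ℝ) (f : SimpleGraph V → ℝ) :
    regMean d (fun G => c * f G) = c * regMean d f := by
  simp only [regMean, ← mul_sum, mul_div_assoc]

lemma regMean_choose (d j : ℕ) :
    regMean d (fun G : SimpleGraph V => ((triSets G).card.choose j : ℝ)) =
      triFamilyCount V d j / regCount d (⊥ : SimpleGraph V) := by
  rw [regMean, triFamilyCount_eq]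

lemma abs_moments_sub_le {d : ℕ} (hd : 3 ≤ d) (hn : 4 * 10 ^ 6 * d ^ 3 ≤ Fintype.card V)
    (hdn : d ^ 9 ≤ Fintype.card V) (hM : regCount d (⊥ : SimpleGraph V) ≠ 0) {x : ℝ}
    (hx : x = regMean d fun G : SimpleGraph V => ((triSets G).card : ℝ)) :
    |regMean d (fun G : SimpleGraph V => ((triSets G).card : ℝ) ^ 2) - x ^ 2 - x| ≤ 10 ^ 10 ∧
    |regMean d (fun G : SimpleGraph V => ((triSets G).card : ℝ) ^ 3) - x ^ 3 - 3 * x ^ 2| ≤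
      10 ^ 10 * x ∧
    |regMean d (fun G : SimpleGraph V => ((triSets G).card : ℝ) ^ 4) - x ^ 4 - 6 * x ^ 3| ≤
      10 ^ 10 * x ^ 2 := by
  set M := regCount d (⊥ : SimpleGraph V) with hMdef
  have hM0 : 0 < M := lt_of_le_of_ne (regCount_nonneg _ _) hM.symm
  have hD : (3 : ℝ) ≤ d := by exact_mod_cast hd
  have hd3 : d ≤ d ^ 3 := Nat.le_self_pow (by norm_num) d
  have hN : (1 : ℝ) ≤ Fintype.card V := by exact_mod_cast (by omega : 1 ≤ Fintype.card V)
  have hlam : (1 : ℝ) ≤ (d - 1) ^ 3 / 6 := by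
    have : (2 : ℝ) ^ 3 ≤ (d - 1) ^ 3 := pow_le_pow_left₀ (by norm_num) (by linarith) 3
    linarith
  set lam : ℝ := (d - 1) ^ 3 / 6 with hlamdef
  set ε : ℝ := 10 ^ 6 * d ^ 3 / Fintype.card V with hε
  have hε0 : 0 ≤ ε := by positivity
  have hε1 : ε ≤ 1 / 4 := by
    have : (4 * 10 ^ 6 * d ^ 3 : ℝ) ≤ Fintype.card V := by exact_mod_cast hn
    rw [hε, div_le_iff₀ (by linarith)]
    linarith
  have hK : ε * lam ^ 2 ≤ 10 ^ 6 := by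
    have h9 : (d : ℝ) ^ 9 ≤ Fintype.card V := by exact_mod_cast hdn
    have hl : lam ≤ d ^ 3 := by
      have : ((d : ℝ) - 1) ^ 3 ≤ d ^ 3 := pow_le_pow_left₀ (by linarith) (by linarith) 3
      have : (0 : ℝ) ≤ d ^ 3 := by positivity
      linarith
    calc ε * lam ^ 2 ≤ ε * ((d : ℝ) ^ 3) ^ 2 := by gcongr
      _ = 10 ^ 6 * ((d : ℝ) ^ 9 / Fintype.card V) := by rw [hε]; ring
      _ ≤ 10 ^ 6 * 1 := by
          gcongr
          exact (div_le_one (by linarith)).2 h9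
      _ = 10 ^ 6 := mul_one _
  set T := fun j => triFamilyCount V d j / M with hT
  have hT0 : T 0 = 1 := by
    have : triFamilyCount V d 0 = M := by simp [triFamilyCount_eq, hMdef, regCount]
    simp only [hT, this]
    exact div_self hM
  have hTn : ∀ j, 0 ≤ T j := fun j => div_nonneg (triFamilyCount_nonneg d j) hM0.le
  have hrec (j : ℕ) (hj : j ≤ 3) : |(j + 1) * T (j + 1) - lam * T j| ≤ ε * (lam * T j) := by
    have h := abs_triFamilyCount_succ_sub_le (V := V) hd hn hj
    have e1 : (j + 1) * T (j + 1) - lam * T j =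
        ((j + 1) * triFamilyCount V d (j + 1) - lam * triFamilyCount V d j) / M := by
      simp only [hT]
      ring
    have e2 : ε * (lam * T j) = ε * (lam * triFamilyCount V d j) / M := by
      simp only [hT]
      ring
    rw [e1, e2, abs_div, abs_of_pos hM0]
    exact div_le_div_of_nonneg_right h hM0.le
  have mean (j : ℕ) : regMean d (fun G : SimpleGraph V => ((triSets G).card.choose j : ℝ)) = T j :=
    regMean_choose d j
  have hx1 : x = T 1 := by
    rw [hx, ← mean 1]
    simp only [Nat.choose_one_right]
  have r0 := hrec 0 (by norm_num)
  have r1 := hrec 1 (by norm_num)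
  have r2 := hrec 2 (by norm_num)
  have r3 := hrec 3 (by norm_num)
  norm_num at r0 r1 r2 r3
  rw [hT0, mul_one, ← hx1] at r0
  rw [← hx1] at r1
  have scale {a b c t : ℝ} (hc : 0 ≤ c) (h : |a - lam * b| ≤ ε * (lam * b)) (ha : c * a = t) :
      |t - lam * (c * b)| ≤ ε * (lam * (c * b)) := by
    rw [← ha, show c * a - lam * (c * b) = c * (a - lam * b) by ring, abs_mul, abs_of_nonneg hc]
    calc _ ≤ c * (ε * (lam * b)) := mul_le_mul_of_nonneg_left h hc
      _ = _ := by ring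
  obtain ⟨b2, b3, b4, hx2⟩ := moment_bounds hlam hε0 hε1 hK r0 r1
    (scale (by norm_num) r2 (by ring : 2 * (3 * T 3) = 6 * T 3))
    (scale (by norm_num) r3 (by ring : 6 * (4 * T 4) = 24 * T 4))
    (mul_nonneg (by norm_num) (hTn 2)) (mul_nonneg (by norm_num) (hTn 3))
  have c2 (n : ℕ) : (n : ℝ) * (n - 1) = 2 * n.choose 2 := by
    rw [Nat.cast_choose_two]
    ring
  have c3 (n : ℕ) : (n : ℝ) * (n - 1) * (n - 2) = 6 * n.choose 3 := by
    have := Nat.choose_succ_right_eq n 2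
    rcases le_or_gt 2 n with h | h
    · have h' : (n.choose 3 : ℝ) * (2 + 1) = n.choose 2 * (n - 2) := by
        exact_mod_cast this
      linear_combination (n - 2 : ℝ) * c2 n - 2 * h'
    · interval_cases n <;> simp [Nat.choose]
  have c4 (n : ℕ) : (n : ℝ) * (n - 1) * (n - 2) * (n - 3) = 24 * n.choose 4 := by
    have := Nat.choose_succ_right_eq n 3
    rcases le_or_gt 3 n with h | h
    · have h' : (n.choose 4 : ℝ) * (3 + 1) = n.choose 3 * (n - 3) := by
        exact_mod_cast this
      linear_combination (n - 3 : ℝ) * c3 n - 6 * h'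
    · interval_cases n <;> simp [Nat.choose]
  have m2 : regMean d (fun G : SimpleGraph V => ((triSets G).card : ℝ) ^ 2) = 2 * T 2 + x := by
    rw [← mean, ← regMean_const_mul, hx, ← regMean_add]
    congr 1
    funext G
    linear_combination c2 (triSets G).card
  have m3 : regMean d (fun G : SimpleGraph V => ((triSets G).card : ℝ) ^ 3) =
      6 * T 3 + 3 * (2 * T 2) + x := by
    rw [← mean, ← mean, ← regMean_const_mul, ← regMean_const_mul, ← regMean_const_mul, hx,
      ← regMean_add, ← regMean_add]
    congr 1
    funext G
    linear_combination c3 (triSets G).card + 3 * c2 (triSets G).card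
  have m4 : regMean d (fun G : SimpleGraph V => ((triSets G).card : ℝ) ^ 4) =
      24 * T 4 + 6 * (6 * T 3) + 7 * (2 * T 2) + x := by
    rw [← mean, ← mean, ← mean, ← regMean_const_mul, ← regMean_const_mul, ← regMean_const_mul,
      ← regMean_const_mul, ← regMean_const_mul, hx, ← regMean_add, ← regMean_add, ← regMean_add]
    congr 1
    funext G
    linear_combination c4 (triSets G).card + 6 * c3 (triSets G).card + 7 * c2 (triSets G).card
  rw [m2, m3, m4]
  have hxx : x ≤ 2 * x ^ 2 := by nlinarith
  rw [abs_le] at b2 b3 b4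
  refine ⟨?_, ?_, ?_⟩ <;> rw [abs_le] <;> constructor <;> linarith

lemma expec_mu_eq_regMean {n : ℕ} (d : ℕ) (f : SimpleGraph (Fin n) → ℝ) :
    expec (mu n d) f = regMean d f := by
  have hreg : ∀ G : SimpleGraph (Fin n), IsRegularGraph G d ↔ G ∈ regAbove d ⊥ := by
    intro G
    simp only [IsRegularGraph, mem_regAbove, bot_le, true_and, gDeg, nbrCard,
      Nat.card_eq_fintype_card, Fintype.card_subtype]
  have hcard : (Nat.card {H : SimpleGraph (Fin n) // IsRegularGraph H d} : ℝ) =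
      regCount d (⊥ : SimpleGraph (Fin n)) := by
    rw [regCount, Nat.card_eq_fintype_card, Fintype.card_subtype]
    congr 2
    ext G
    simp [hreg]
  rw [expec, tsum_fintype, regMean, sum_div, ← sum_subset (subset_univ (regAbove d ⊥))]
  · refine sum_congr rfl fun G hG => ?_
    rw [mu, if_pos ((hreg G).2 hG), hcard, inv_mul_eq_div]
  · intro G _ hG
    rw [mu, if_neg fun h => hG ((hreg G).1 h), zero_mul]

lemma triCount_eq_card_triSets {n : ℕ} (G : SimpleGraph (Fin n)) :
    triCount G = (triSets G).card := by
  rw [triCount, Nat.card_eq_fintype_card, Fintype.card_subtype]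
  congr 1
  ext T
  rw [mem_filter, mem_triSets, mem_powersetCard, SimpleGraph.isNClique_iff]
  simp only [mem_univ, true_and, subset_univ]
  rw [and_comm]
  refine and_congr_right fun _ => ⟨fun h x y hxy => h hxy.1 hxy.2.1 hxy.2.2,
    fun h x hx y hy hxy => h ⟨hx, hy, hxy⟩⟩

lemma le_of_rpow_bound {n d : ℕ} (hn : 10 ^ 10 ≤ n) (hd : 3 ≤ d)
    (h : (d : ℝ) ≤ (n : ℝ) ^ ((1 : ℝ) / 10)) :
    d ^ 9 ≤ n ∧ 4 * 10 ^ 6 * d ^ 3 ≤ n := by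
  have h10 : d ^ 10 ≤ n := by
    have h1 := pow_le_pow_left₀ (Nat.cast_nonneg d) h 10
    rw [← Real.rpow_natCast (_ ^ _), ← Real.rpow_mul (Nat.cast_nonneg n)] at h1
    norm_num at h1
    exact_mod_cast h1
  refine ⟨(Nat.pow_le_pow_right (by omega) (by norm_num)).trans h10, ?_⟩
  rcases Nat.lt_or_ge d 9 with h9 | h9
  · have : d ^ 3 ≤ 8 ^ 3 := Nat.pow_le_pow_left (by omega) 3
    omega
  · refine le_trans ?_ h10
    have : 9 ^ 7 ≤ d ^ 7 := Nat.pow_le_pow_left h9 7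
    calc 4 * 10 ^ 6 * d ^ 3 ≤ d ^ 7 * d ^ 3 := Nat.mul_le_mul_right _ (le_trans (by norm_num) this)
      _ = d ^ 10 := by ring

end RandomRegular

/-- For each `k ∈ {2,3,4}` there are `C_k > 0` and `n₀` such that for
every even `n = 2m ≥ n₀` and `3 ≤ d ≤ n^{1/10}`, the number `X` of triangles of
`G ~ μ_{d,n}` satisfies `|E[X^k] - E[X]^k - (k choose 2) E[X]^{k-1}| ≤ C_k E[X]^{k-2}`. -/
theorem statement_14 (k : ℕ) (hk : k ∈ ({2, 3, 4} : Set ℕ)) :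
    ∃ C : ℝ, 0 < C ∧ ∃ n₀ : ℕ,
      ∀ m d : ℕ, n₀ ≤ 2*m → 3 ≤ d → (d : ℝ) ≤ ((2*m : ℕ) : ℝ) ^ ((1:ℝ)/10) →
        |expec (mu (2*m) d) (fun G => (triCount G : ℝ) ^ k) -
            (expec (mu (2*m) d) (fun G => (triCount G : ℝ))) ^ k -
            (Nat.choose k 2 : ℝ) *
              (expec (mu (2*m) d) (fun G => (triCount G : ℝ))) ^ (k-1)| ≤
          C * (expec (mu (2*m) d) (fun G => (triCount G : ℝ))) ^ (k-2) := by
  refine ⟨10 ^ 10, by norm_num, 10 ^ 10, fun m d hn hd hdn => ?_⟩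
  obtain ⟨h9, h3⟩ := le_of_rpow_bound hn hd hdn
  simp only [expec_mu_eq_regMean, triCount_eq_card_triSets]
  by_cases hM : regCount d (⊥ : SimpleGraph (Fin (2 * m))) = 0
  · have h0 : ∀ f : SimpleGraph (Fin (2 * m)) → ℝ, regMean d f = 0 := by
      intro f
      rw [regMean, hM, div_zero]
    simp only [h0]
    rcases hk with rfl | rfl | rfl <;> norm_num
  · obtain ⟨b2, b3, b4⟩ := abs_moments_sub_le hd (by rwa [Fintype.card_fin])
      (by rwa [Fintype.card_fin]) hM rfl
    rcases hk with rfl | rfl | rfl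
    · simpa using b2
    · simpa [Nat.choose] using b3
    · simpa [Nat.choose] using b4
end
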